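/- Linear independence over 𝔽̄_q(θ) (homogeneous part of the transcendence theorem): for every N ∈ ℕ and w ∈ ℕ, the family {μ(𝛆)·Li(𝛆;𝔰) : 𝔰 ∈ S_w, 𝛆 ∈ Γ_N^{depth(𝔰)}}, indexed by the pairs (𝔰,𝛆) and regarded inside 𝔽̄_q((1/θ)), is linearly independent over the field 𝔽̄_q(θ). -/

import Mathlib

noncomputable section

open scoped Classical

namespace ZHPC

variable (Fq : Type) [Field Fq] [Fintype Fq]

/-- `q`, the cardinality of the base finite field `𝔽_q`. -/
def qc : ℕ := Fintype.card Fq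

/-- A fixed algebraic closure `𝔽̄_q` of `𝔽_q`. -/
abbrev Fb := AlgebraicClosure Fq

/-- The field `𝔽̄_q((1/θ))` of formal Laurent series in `1/θ` over `𝔽̄_q`, modeled as the
field of formal Laurent series in one variable, `θ` being the inverse of that variable. -/
abbrev Kinf := LaurentSeries (Fb Fq)

/-- The embedding of the constants `𝔽̄_q → 𝔽̄_q((1/θ))`. -/
def cst : Fb Fq →+* Kinf Fq := HahnSeries.C

/-- The element `θ`. -/
def theta : Kinf Fq := HahnSeries.single (-1 : ℤ) 1

/-- `ℓ_d = ∏_{i=1}^{d} (θ - θ^{q^i})`, with `ℓ_0 = 1`. -/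
def ell (d : ℕ) : Kinf Fq := ∏ i ∈ Finset.Icc 1 d, (theta Fq - theta Fq ^ qc Fq ^ i)

/-- Arrays `(𝛆;𝔰)` of some depth `n`. -/
structure PArr (F : Type) where
  depth : ℕ
  s : Fin depth → ℕ
  eps : Fin depth → F

namespace PArr

variable {F : Type}

/-- A *positive array* for level `N`: all entries `sᵢ` are positive integers and all the
characters `εᵢ` are `N`-th roots of unity. -/
def Positive [Monoid F] (N : ℕ) (A : PArr F) : Prop := (∀ i, 0 < A.s i) ∧ ∀ i, A.eps i ^ N = 1

/-- The weight `w(𝔰) = s₁ + ⋯ + s_n`. -/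
def wt (A : PArr F) : ℕ := ∑ i, A.s i

/-- The `i`-th entry of `𝔰` (`0`-indexed), with value `0` beyond the depth. -/
def sAt (A : PArr F) (i : ℕ) : ℕ := if h : i < A.depth then A.s ⟨i, h⟩ else 0

/-- The partial sums `s₁ + ⋯ + s_i` (entries beyond the depth being `0`). -/
def psum (A : PArr F) (i : ℕ) : ℕ := ∑ j ∈ Finset.range i, A.sAt j

/-- The character `χ(𝛆) = ε₁ ⋯ ε_n`. -/
def chi [CommMonoid F] (A : PArr F) : F := ∏ i, A.eps i

end PArr

/-- The Carlitz multiple polylogarithm at roots of unity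
`Li(𝛆;𝔰) = Σ_{d₁ > ⋯ > d_n ≥ 0} ε₁^{d₁}⋯ε_n^{d_n} / (ℓ_{d₁}^{s₁}⋯ℓ_{d_n}^{s_n})`. -/
def Li (A : PArr (Fb Fq)) : Kinf Fq :=
  ∑' d : {f : Fin A.depth → ℕ // StrictAnti f},
    ∏ i, cst Fq (A.eps i ^ d.1 i) / ell Fq (d.1 i) ^ A.s i

/-- `Si_d(𝛆;𝔰)`: same summand as `Li`, over decreasing tuples with `d₁ = d`. -/
def Sid (d : ℤ) (A : PArr (Fb Fq)) : Kinf Fq :=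
  ∑' f : {f : Fin A.depth → ℕ // StrictAnti f ∧ ∀ i : Fin A.depth, i.val = 0 → (f i : ℤ) = d},
    ∏ i, cst Fq (A.eps i ^ f.1 i) / ell Fq (f.1 i) ^ A.s i

/-- `Si_{<d}(𝛆;𝔰)`: same summand as `Li`, over decreasing tuples with `d > d₁`. -/
def SidLt (d : ℤ) (A : PArr (Fb Fq)) : Kinf Fq :=
  ∑' f : {f : Fin A.depth → ℕ // StrictAnti f ∧ ∀ i : Fin A.depth, (f i : ℤ) < d},
    ∏ i, cst Fq (A.eps i ^ f.1 i) / ell Fq (f.1 i) ^ A.s i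

/-- The value at `θ` of the monic polynomial `θ^e + Σ_{j<e} c_j θ^j ∈ A = 𝔽_q[θ]`. -/
def monicVal (e : ℕ) (c : Fin e → Fq) : Kinf Fq :=
  theta Fq ^ e + ∑ j, cst Fq (algebraMap Fq (Fb Fq) (c j)) * theta Fq ^ (j : ℕ)

/-- The power sum `S_d(𝛆;𝔰)`, a sum over tuples of monic polynomials `a₁, …, a_n ∈ A₊`
with `d = deg a₁ > ⋯ > deg a_n ≥ 0`; a monic polynomial of degree `e` is encoded by its
tuple of lower coefficients `c : Fin e → Fq`. -/
def Sd (d : ℤ) (A : PArr (Fb Fq)) : Kinf Fq :=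
  ∑' e : {f : Fin A.depth → ℕ // StrictAnti f ∧ ∀ i : Fin A.depth, i.val = 0 → (f i : ℤ) = d},
    ∑ c : (∀ i, Fin (e.1 i) → Fq),
      ∏ i, cst Fq (A.eps i ^ e.1 i) / monicVal Fq (e.1 i) (c i) ^ A.s i

/-- The `N`-th cyclotomic multiple zeta value `ζ_A(𝛆;𝔰) = Σ_{d ≥ 0} S_d(𝛆;𝔰)`. -/
def zetaA (A : PArr (Fb Fq)) : Kinf Fq := ∑' d : ℕ, Sd Fq (d : ℤ) A

/-- The cyclotomic field `k_N = 𝔽_q(ζ_N) ⊆ 𝔽̄_q`. -/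
def kN (N : ℕ) : Subfield (Fb Fq) :=
  Subfield.closure (Set.range (algebraMap Fq (Fb Fq)) ∪ {x | x ^ N = 1})

/-- The field `K_N = k_N(θ)`, as a subfield of `𝔽̄_q((1/θ))`. -/
def KNf (N : ℕ) : Subfield (Kinf Fq) :=
  Subfield.closure ((cst Fq '' (kN Fq N : Set (Fb Fq))) ∪ {theta Fq})

/-- The ring `A_N = k_N[θ]`, as a subring of `𝔽̄_q((1/θ))`. -/
def AN (N : ℕ) : Subring (Kinf Fq) :=
  Subring.closure ((cst Fq '' (kN Fq N : Set (Fb Fq))) ∪ {theta Fq})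

/-- `CZ_{N,w}`: the `K_N`-span of the `N`-th cyclotomic multiple zeta values of weight `w`. -/
def CZ (N w : ℕ) : Submodule (KNf Fq N) (Kinf Fq) :=
  Submodule.span (KNf Fq N) {x | ∃ A : PArr (Fb Fq), A.Positive N ∧ A.wt = w ∧ x = zetaA Fq A}

/-- `CL_{N,w}`: the `K_N`-span of the CMPL's at `N`-th roots of unity of weight `w`. -/
def CL (N w : ℕ) : Submodule (KNf Fq N) (Kinf Fq) :=
  Submodule.span (KNf Fq N) {x | ∃ A : PArr (Fb Fq), A.Positive N ∧ A.wt = w ∧ x = Li Fq A}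

/-- The index set of pairs `(𝔰,𝛆)` with `𝔰 ∈ S_w` and `𝛆 ∈ Γ_N^{depth 𝔰}`: positive arrays
of weight `w` with `q ∤ sᵢ` for all `i`. -/
def SwIdx (N w : ℕ) : Type :=
  {A : PArr (Fb Fq) // A.Positive N ∧ 0 < A.depth ∧ A.wt = w ∧ ∀ i, ¬ qc Fq ∣ A.s i}

/-- `R = [k_N : 𝔽_q]`: the least `r ≥ 1` such that all `N`-th roots of unity lie in
`𝔽_{q^r}` (the fixed field of the `r`-th iterate of the `q`-Frobenius). -/
def Rdeg (N : ℕ) : ℕ := sInf {r | 0 < r ∧ ∀ x : Fb Fq, x ^ N = 1 → x ^ qc Fq ^ r = x}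

/-- The field `𝔽̄_q(θ)`, as a subfield of `𝔽̄_q((1/θ))`. -/
def Fbtheta : Subfield (Kinf Fq) :=
  Subfield.closure ((Set.range fun x : Fb Fq => cst Fq x) ∪ {theta Fq})

set_option synthInstance.maxHeartbeats 1000000


/-! ### Generic nested sums -/

section Nested

variable {α R R' : Type} [CommRing R] [CommRing R']

/-- Nested sums over strictly decreasing sequences in `[lo, hi)`. -/
def NS (g : α → ℕ → R) (lo : ℕ) : List α → ℕ → R
  | [], _ => 1
  | a :: w, hi => ∑ d ∈ Finset.Ico lo hi, g a d * NS g lo w d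

lemma NS_nil (g : α → ℕ → R) (lo hi : ℕ) : NS g lo [] hi = 1 := rfl

lemma NS_cons (g : α → ℕ → R) (lo : ℕ) (a : α) (w : List α) (hi : ℕ) :
    NS g lo (a :: w) hi = ∑ d ∈ Finset.Ico lo hi, g a d * NS g lo w d := rfl

lemma NS_congr (g g' : α → ℕ → R) (lo : ℕ) (w : List α) (hi : ℕ)
    (h : ∀ a ∈ w, ∀ d, lo ≤ d → d < hi → g a d = g' a d) : NS g lo w hi = NS g' lo w hi := by
  induction w generalizing hi with
  | nil => rfl
  | cons a w ih =>
    rw [NS_cons, NS_cons]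
    refine Finset.sum_congr rfl fun d hd => ?_
    rw [Finset.mem_Ico] at hd
    rw [h a (by simp) d hd.1 hd.2, ih d]
    intro b hb e he1 he2
    exact h b (by simp [hb]) e he1 (by omega)

lemma NS_map (φ : R →+* R') (g : α → ℕ → R) (lo : ℕ) (w : List α) (hi : ℕ) :
    φ (NS g lo w hi) = NS (fun a d => φ (g a d)) lo w hi := by
  induction w generalizing hi with
  | nil => simp [NS_nil]
  | cons a w ih => simp [NS_cons, ih]

lemma NS_scale (c : α → R) (g : α → ℕ → R) (lo : ℕ) (w : List α) (hi : ℕ) :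
    NS (fun a d => c a * g a d) lo w hi = (w.map c).prod * NS g lo w hi := by
  induction w generalizing hi with
  | nil => simp [NS_nil]
  | cons a w ih =>
    simp only [NS_cons, ih, List.map_cons, List.prod_cons, Finset.mul_sum]
    refine Finset.sum_congr rfl fun d _ => by ring

lemma NS_shift (g : α → ℕ → R) (lo k : ℕ) (w : List α) (hi : ℕ) :
    NS g (lo + k) w (hi + k) = NS (fun a d => g a (d + k)) lo w hi := by
  induction w generalizing hi with
  | nil => simp [NS_nil]
  | cons a w ih =>
    simp only [NS_cons]
    rw [← Finset.sum_Ico_add' (fun d => g a d * NS g (lo + k) w d)]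
    refine Finset.sum_congr rfl fun d _ => by rw [ih]

lemma NS_split (g : α → ℕ → R) (lo mid : ℕ) (hlm : lo ≤ mid) (w : List α) (hi : ℕ)
    (hmh : mid ≤ hi) :
    NS g lo w hi = ∑ k ∈ Finset.range (w.length + 1),
      NS g mid (w.take k) hi * NS g lo (w.drop k) mid := by
  induction w generalizing hi with
  | nil => simp [NS_nil]
  | cons a w ih =>
    rw [List.length_cons, Finset.sum_range_succ']
    simp only [List.take_succ_cons, List.drop_succ_cons, List.take_zero, List.drop_zero, NS_nil,
      one_mul]
    rw [NS_cons g lo a w hi, ← Finset.sum_Ico_consecutive _ hlm hmh, add_comm, NS_cons g lo a w mid]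
    congr 1
    simp only [NS_cons, Finset.sum_mul]
    rw [Finset.sum_comm]
    refine Finset.sum_congr rfl fun d hd => ?_
    rw [Finset.mem_Ico] at hd
    rw [ih d hd.1, Finset.mul_sum]
    refine Finset.sum_congr rfl fun d _ => by ring

/-- Strictly decreasing lists of length `n` with entries in `[0, hi)`. -/
def Dec : ℕ → ℕ → Finset (List ℕ)
  | 0, _ => {[]}
  | n + 1, hi => (Finset.range hi).biUnion fun d => (Dec n d).image (List.cons d)

lemma mem_Dec (n hi : ℕ) (l : List ℕ) :
    l ∈ Dec n hi ↔ l.length = n ∧ l.Pairwise (· > ·) ∧ ∀ x ∈ l, x < hi := by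
  induction n generalizing hi l with
  | zero =>
    simp only [Dec, Finset.mem_singleton, List.length_eq_zero_iff]
    constructor
    · rintro rfl; simp
    · exact fun h => h.1
  | succ n ih =>
    simp only [Dec, Finset.mem_biUnion, Finset.mem_range, Finset.mem_image, ih]
    constructor
    · rintro ⟨d, hd, l, ⟨h1, h2, h3⟩, rfl⟩
      refine ⟨by simp [h1], by simpa using ⟨h3, h2⟩, ?_⟩
      intro x hx
      rcases List.mem_cons.1 hx with rfl | hx
      · exact hd
      · exact (h3 x hx).trans hd
    · rintro ⟨h1, h2, h3⟩
      cases l with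
      | nil => simp at h1
      | cons d l =>
        rw [List.pairwise_cons] at h2
        exact ⟨d, h3 d (by simp), l, ⟨by simpa using h1, h2.2, h2.1⟩, rfl⟩

lemma NS_eq_sum (g : α → ℕ → R) (w : List α) (hi : ℕ) :
    NS g 0 w hi = ∑ l ∈ Dec w.length hi, (List.zipWith g w l).prod := by
  induction w generalizing hi with
  | nil => simp [NS_nil, Dec]
  | cons a w ih =>
    rw [NS_cons, List.length_cons, Dec, Finset.sum_biUnion]
    · rw [Finset.range_eq_Ico]
      refine Finset.sum_congr rfl fun d _ => ?_
      rw [Finset.sum_image (fun x _ y _ h => by simpa using h), ih, Finset.mul_sum]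
      simp
    · intro d _ e _ hde
      rw [Function.onFun, Finset.disjoint_left]
      intro l hl hl'
      simp only [Finset.mem_image] at hl hl'
      obtain ⟨x, _, rfl⟩ := hl
      obtain ⟨y, _, h⟩ := hl'
      simp only [List.cons.injEq] at h
      exact hde h.1.symm

end Nested

/-! ### Combinatorics of exponents -/

/-- `∑ s q^e` over a multiset of pairs `(s, e)`. -/
def val (q : ℕ) (P : Multiset (ℕ × ℕ)) : ℤ := (P.map fun x => ((x.1 : ℤ) * (q : ℤ) ^ x.2)).sum

lemma val_add (q : ℕ) (P P' : Multiset (ℕ × ℕ)) : val q (P + P') = val q P + val q P' := by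
  simp [val]

lemma val_cons (q : ℕ) (x : ℕ × ℕ) (P : Multiset (ℕ × ℕ)) :
    val q (x ::ₘ P) = (x.1 : ℤ) * (q : ℤ) ^ x.2 + val q P := by
  simp [val]

lemma val_nonneg (q : ℕ) (P : Multiset (ℕ × ℕ)) : 0 ≤ val q P := by
  refine Multiset.sum_nonneg ?_
  intro x hx
  rw [Multiset.mem_map] at hx
  obtain ⟨y, _, rfl⟩ := hx
  positivity

lemma val_le (q : ℕ) (hq : 2 ≤ q) (P : Multiset (ℕ × ℕ)) (e : ℕ) (h : ∀ x ∈ P, x.2 ≤ e) :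
    val q P ≤ ((P.map Prod.fst).sum : ℕ) * (q : ℤ) ^ e := by
  induction P using Multiset.induction_on with
  | empty => simp [val]
  | cons x P ih =>
    have h1 := ih fun y hy => h y (by simp [hy])
    have h2 : (q : ℤ) ^ x.2 ≤ (q : ℤ) ^ e :=
      pow_le_pow_right₀ (by exact_mod_cast (by omega : 1 ≤ q)) (h x (by simp))
    rw [val_cons]
    simp only [Multiset.map_cons, Multiset.sum_cons]
    push_cast at h1 ⊢
    nlinarith [mul_le_mul_of_nonneg_left h2 (Int.natCast_nonneg x.1)]

lemma val_dvd (q : ℕ) (P : Multiset (ℕ × ℕ)) (e : ℕ) (h : ∀ x ∈ P, e ≤ x.2) :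
    (q : ℤ) ^ e ∣ val q P := by
  refine Multiset.dvd_sum ?_
  intro x hx
  rw [Multiset.mem_map] at hx
  obtain ⟨y, hy, rfl⟩ := hx
  exact Dvd.dvd.mul_left (pow_dvd_pow _ (h y hy)) _

/-- Well-spaced lists above base `b`, with lowest exponent first. -/
def Spaced (K : ℕ) : ℕ → List (ℕ × ℕ) → Prop
  | _, [] => True
  | b, x :: P => b + K ≤ x.2 ∧ Spaced K x.2 P

lemma Spaced.le {K b : ℕ} {P : List (ℕ × ℕ)} (h : Spaced K b P) : ∀ x ∈ P, b + K ≤ x.2 := by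
  induction P generalizing b with
  | nil => simp
  | cons y P ih =>
    intro x hx
    rcases List.mem_cons.1 hx with rfl | hx
    · exact h.1
    · have := ih h.2 x hx
      have := h.1
      omega

set_option maxHeartbeats 1000000 in
lemma comb (q w K : ℕ) (C : ℤ) (hq : 2 ≤ q) (hC : 2 * (w : ℤ) + 1 ≤ C)
    (hK : ((w : ℤ) + 1) * C < (q : ℤ) ^ K)
    (P : List (ℕ × ℕ)) (b : ℕ) (c : ℤ) (P' : Multiset (ℕ × ℕ))
    (hP : Spaced K b P) (hPw : ∀ x ∈ P, x.1 ≤ w) (hPq : ∀ x ∈ P, ¬ q ∣ x.1)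
    (hP'w : (P'.map Prod.fst).sum ≤ w) (hP'q : ∀ x ∈ P', ¬ q ∣ x.1) (hP'b : ∀ x ∈ P', b < x.2)
    (hcard : P'.card ≤ P.length) (hc : |c| ≤ C * (q : ℤ) ^ b)
    (heq : val q P = val q P' + c) : P' = (P : Multiset (ℕ × ℕ)) ∧ c = 0 := by
  have hq0 : (0 : ℤ) < q := by exact_mod_cast (by omega : 0 < q)
  have hq1 : (1 : ℤ) ≤ q := hq0
  have hw0 : (0 : ℤ) ≤ w := Int.natCast_nonneg w
  induction P generalizing b c P' with
  | nil =>
    have h0 : P' = 0 := by simpa using hcard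
    subst h0
    simp [val] at heq ⊢
    exact heq.symm
  | cons x P ih =>
    obtain ⟨s, e⟩ := x
    have hbe : b + K ≤ e := hP.1
    have hspw : ∀ x ∈ P, x.1 ≤ w := fun x hx => hPw x (by simp [hx])
    have hspq : ∀ x ∈ P, ¬ q ∣ x.1 := fun x hx => hPq x (by simp [hx])
    have hsw : s ≤ w := hPw (s, e) (by simp)
    have hsq : ¬ q ∣ s := hPq (s, e) (by simp)
    have hs1 : 1 ≤ s := by
      rcases Nat.eq_zero_or_pos s with h | h
      · exact absurd (h ▸ dvd_zero q) hsq
      · exact h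
    set L := P'.filter (fun x => x.2 ≤ e) with hL
    set U := P'.filter (fun x => ¬ x.2 ≤ e) with hU
    have hLU : L + U = P' := Multiset.filter_add_not _ _
    have hLmem : ∀ x ∈ L, x ∈ P' ∧ x.2 ≤ e := fun x hx => by simpa [hL] using hx
    have hUmem : ∀ x ∈ U, x ∈ P' ∧ e < x.2 := fun x hx => by simpa [hU] using hx
    have hsum : (L.map Prod.fst).sum + (U.map Prod.fst).sum ≤ w := by
      rw [← Multiset.sum_add, ← Multiset.map_add, hLU]; exact hP'w
    have hvL := val_le q hq L e fun x hx => (hLmem x hx).2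
    have hvL0 := val_nonneg q L
    have hvP : val q ((s, e) :: P : List (ℕ × ℕ)) = (s : ℤ) * (q : ℤ) ^ e + val q (P : Multiset _) := by
      rw [← Multiset.cons_coe, val_cons]
    have hvP' : val q P' = val q L + val q U := by rw [← hLU, val_add]
    rw [hvP, hvP'] at heq
    -- sizes
    have hqe : (0 : ℤ) < (q : ℤ) ^ e := by positivity
    have hqb : (0 : ℤ) < (q : ℤ) ^ b := by positivity
    have hpe : (q : ℤ) ^ b * (q : ℤ) ^ K ≤ (q : ℤ) ^ e := by
      rw [← pow_add]; exact pow_le_pow_right₀ hq1 hbe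
    have hbig : ((w : ℤ) + 1) * C * (q : ℤ) ^ b < (q : ℤ) ^ e := by nlinarith
    have hC0 : 0 < C := by linarith
    have hCb : C * (q : ℤ) ^ b < (q : ℤ) ^ e := by nlinarith [mul_pos hC0 hqb]
    have hLw : val q L ≤ w * (q : ℤ) ^ e := by
      refine hvL.trans (mul_le_mul_of_nonneg_right ?_ hqe.le)
      exact_mod_cast (by omega : (L.map Prod.fst).sum ≤ w)
    have hsw' : (s : ℤ) * (q : ℤ) ^ e ≤ w * (q : ℤ) ^ e :=
      mul_le_mul_of_nonneg_right (by exact_mod_cast hsw) hqe.le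
    have hs0' : 0 ≤ (s : ℤ) * (q : ℤ) ^ e := by positivity
    obtain ⟨hc1, hc2⟩ := abs_le.1 hc
    -- L nonempty
    have hLne : L ≠ 0 := by
      intro h0
      rw [h0] at heq
      have hz : val q 0 = 0 := by simp [val]
      rw [hz, zero_add] at heq
      have d1 : (q : ℤ) ^ (e + 1) ∣ val q U := val_dvd q U _ fun x hx => (hUmem x hx).2
      have d2 : (q : ℤ) ^ (e + 1) ∣ val q (P : Multiset _) := by
        refine val_dvd q _ _ fun x hx => ?_
        have := hP.2.le x (by simpa using hx)
        have hK0 : 1 ≤ K := by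
          by_contra hk
          have : K = 0 := by omega
          subst this
          simp at hK
          nlinarith
        simp only at this ⊢
        omega
      have d3 : (q : ℤ) ^ (e + 1) ∣ (s : ℤ) * (q : ℤ) ^ e - c := by
        have : (s : ℤ) * (q : ℤ) ^ e - c = val q U - val q (P : Multiset _) := by linarith
        rw [this]; exact dvd_sub d1 d2
      have d4 : (q : ℤ) ^ e ∣ c := by
        have h1 : (q : ℤ) ^ e ∣ (s : ℤ) * (q : ℤ) ^ e - c := (pow_dvd_pow _ (by omega)).trans d3
        have h2 : (q : ℤ) ^ e ∣ (s : ℤ) * (q : ℤ) ^ e := dvd_mul_left _ _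
        simpa using dvd_sub h2 h1
      have hc0 : c = 0 := Int.eq_zero_of_abs_lt_dvd d4 (by linarith)
      rw [hc0, sub_zero, pow_succ, mul_comm (s : ℤ)] at d3
      have := (mul_dvd_mul_iff_left hqe.ne').1 d3
      exact hsq (by exact_mod_cast this)
    have hLc : 1 ≤ L.card := Multiset.card_pos.2 hLne
    have hcards : L.card + U.card ≤ P.length + 1 := by
      rw [← Multiset.card_add, hLU]; simpa using hcard
    have hCe : (2 * (w : ℤ) + 1) * (q : ℤ) ^ e ≤ C * (q : ℤ) ^ e :=
      mul_le_mul_of_nonneg_right hC hqe.le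
    have hCe' : |val q L + c - s * (q : ℤ) ^ e| ≤ C * (q : ℤ) ^ e := by
      have hw1 : 0 ≤ (w : ℤ) * (q : ℤ) ^ e := by positivity
      rw [abs_le]; constructor <;> linarith
    have := ih e (val q L + c - s * (q : ℤ) ^ e) U hP.2 hspw hspq (by omega)
      (fun x hx => hP'q x (hUmem x hx).1) (fun x hx => (hUmem x hx).2) (by omega)
      hCe' (by linarith)
    obtain ⟨hUP, hc0⟩ := this
    have hUcard : U.card = P.length := by rw [hUP]; simp
    have hL1 : L.card = 1 := by omega
    obtain ⟨⟨s', e'⟩, hLs⟩ := Multiset.card_eq_one.1 hL1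
    have hmem := hLmem (s', e') (by rw [hLs]; simp)
    have hs'q : ¬ q ∣ s' := hP'q _ hmem.1
    have he' : e' ≤ e := hmem.2
    have hvL1 : val q L = s' * (q : ℤ) ^ e' := by rw [hLs]; simp [val]
    have hs'w : s' ≤ w := by
      have : (L.map Prod.fst).sum = s' := by rw [hLs]; simp
      omega
    have hee : e' = e := by
      by_contra hne
      have hlt : e' < e := by omega
      obtain ⟨k, rfl⟩ := Nat.exists_eq_add_of_lt hlt
      have hc3 : c = (q : ℤ) ^ e' * (s * (q : ℤ) ^ (k + 1) - s') := by
        rw [hvL1] at hc0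
        have : (q : ℤ) ^ (e' + k + 1) = (q : ℤ) ^ e' * (q : ℤ) ^ (k + 1) := by rw [← pow_add]; ring_nf
        rw [this] at hc0
        linear_combination hc0
      have hcne : c ≠ 0 := by
        rw [hc3]
        refine mul_ne_zero (by positivity) fun h => hs'q ?_
        have : (q : ℤ) ∣ s' := by
          rw [← sub_eq_zero.1 h, pow_succ]
          exact Dvd.dvd.mul_left (dvd_mul_left _ _) _
        exact_mod_cast this
      have h5 : (q : ℤ) ^ e' ≤ |c| :=
        Int.le_of_dvd (abs_pos.2 hcne) ((dvd_abs _ _).2 (hc3 ▸ dvd_mul_right _ _))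
      rw [hvL1] at hc0
      have hs1' : (1 : ℤ) ≤ s := by exact_mod_cast hs1
      have hs'w' : (s' : ℤ) ≤ w := by exact_mod_cast hs'w
      have h6 : (q : ℤ) ^ e' ≤ C * (q : ℤ) ^ b := h5.trans hc
      have h7 : (s' : ℤ) * (q : ℤ) ^ e' ≤ w * (C * (q : ℤ) ^ b) :=
        mul_le_mul hs'w' h6 (by positivity) hw0
      nlinarith
    subst hee
    rw [hvL1] at hc0
    have hc4 : c = (q : ℤ) ^ e' * (s - s') := by linear_combination hc0
    have hcz : c = 0 := Int.eq_zero_of_abs_lt_dvd (hc4 ▸ dvd_mul_right _ _) (by linarith)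
    have hss : (s : ℤ) - s' = 0 := by
      rw [hcz] at hc4
      rcases mul_eq_zero.1 hc4.symm with h | h
      · exact absurd h hqe.ne'
      · exact h
    have hss' : s = s' := by omega
    refine ⟨?_, hcz⟩
    rw [← hLU, hLs, hUP, hss', ← Multiset.cons_coe]
    simp

/-! ### Independence of the specialised series -/

section Spec

variable {F : Type} [Field F]

/-- Specialised summand. -/
def g2 (q : ℕ) (a : ℕ × F) (d : ℕ) : PowerSeries F :=
  PowerSeries.C (a.2 ^ d) * (∏ l ∈ Finset.range (d + 1), -(PowerSeries.X ^ (q ^ l))) ^ a.1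

/-- Exponent. -/
def ex (q : ℕ) (B : List (ℕ × F)) (l : List ℕ) : ℕ :=
  (List.zipWith (fun a d => a.1 * ∑ i ∈ Finset.range (d + 1), q ^ i) B l).sum

/-- Sign. -/
def sg (F : Type) [Field F] (S : List ℕ) (l : List ℕ) : F :=
  (List.zipWith (fun (s d : ℕ) => ((-1 : F) ^ (d + 1)) ^ s) S l).prod

/-- Character value. -/
def cf (B : List (ℕ × F)) (l : List ℕ) : F :=
  (List.zipWith (fun a d => a.2 ^ d) B l).prod

/-- List of pairs. -/
def pl (B : List (ℕ × F)) (l : List ℕ) : List (ℕ × ℕ) :=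
  List.zip (B.map Prod.fst) (l.map (· + 1))

lemma sg_ne (S : List ℕ) (l : List ℕ) : sg F S l ≠ 0 := by
  induction S generalizing l with
  | nil => simp [sg]
  | cons s S ih =>
    cases l with
    | nil => simp [sg]
    | cons d l =>
      have := ih l
      simp only [sg, List.zipWith_cons_cons, List.prod_cons] at this ⊢
      exact mul_ne_zero (pow_ne_zero _ (pow_ne_zero _ (by simp))) this

lemma g2_eq (q : ℕ) (a : ℕ × F) (d : ℕ) :
    g2 q a d = PowerSeries.C (((-1 : F) ^ (d + 1)) ^ a.1 * a.2 ^ d) *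
      PowerSeries.X ^ (a.1 * ∑ i ∈ Finset.range (d + 1), q ^ i) := by
  have h : (∏ l ∈ Finset.range (d + 1), -(PowerSeries.X ^ (q ^ l) : PowerSeries F)) =
      PowerSeries.C ((-1) ^ (d + 1)) * PowerSeries.X ^ (∑ i ∈ Finset.range (d + 1), q ^ i) := by
    rw [Finset.prod_neg, Finset.prod_pow_eq_pow_sum]
    simp
  rw [g2, h, mul_pow, ← pow_mul, map_mul, mul_comm (∑ i ∈ _, _) a.1, map_pow _ _ a.1]
  ring

lemma prod_g2 (q : ℕ) (B : List (ℕ × F)) (l : List ℕ) :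
    (List.zipWith (g2 q) B l).prod =
      PowerSeries.C (sg F (B.map Prod.fst) l * cf B l) * PowerSeries.X ^ ex q B l := by
  induction B generalizing l with
  | nil => simp [sg, cf, ex]
  | cons a B ih =>
    cases l with
    | nil => simp [sg, cf, ex]
    | cons d l =>
      rw [List.zipWith_cons_cons, List.prod_cons, ih, g2_eq]
      simp only [sg, cf, ex, List.map_cons, List.zipWith_cons_cons, List.prod_cons, List.sum_cons,
        pow_add, map_mul]
      ring

lemma val_pl (q : ℕ) (B : List (ℕ × F)) (l : List ℕ) (h : l.length = B.length) :
    val q (pl B l : Multiset _) = ((q : ℤ) - 1) * ex q B l + ((B.map Prod.fst).sum : ℕ) := by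
  induction B generalizing l with
  | nil => simp [pl, val, ex]
  | cons a B ih =>
    cases l with
    | nil => simp at h
    | cons d l =>
      have h1 := ih l (by simpa using h)
      simp only [pl, List.map_cons, List.zip_cons_cons] at h1 ⊢
      rw [← Multiset.cons_coe, val_cons, h1]
      have h2 := mul_geom_sum (q : ℤ) (d + 1)
      simp only [ex, List.zipWith_cons_cons, List.sum_cons]
      push_cast
      linear_combination (-(a.1 : ℤ)) * h2

lemma ex_le (q T : ℕ) (hq : 2 ≤ q) (B : List (ℕ × F)) (l : List ℕ) (h : ∀ d ∈ l, d < T) :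
    ex q B l ≤ (B.map Prod.fst).sum * q ^ T := by
  induction B generalizing l with
  | nil => simp [ex]
  | cons a B ih =>
    cases l with
    | nil => simp [ex]
    | cons d l =>
      have h1 := ih l (fun x hx => h x (by simp [hx]))
      simp only [ex, List.zipWith_cons_cons, List.sum_cons, List.map_cons] at h1 ⊢
      have h2 : ∑ i ∈ Finset.range (d + 1), q ^ i ≤ q ^ T := by
        have h3 : ∑ i ∈ Finset.range (d + 1), q ^ i < q ^ (d + 1) :=
          Nat.geomSum_lt hq (by simp)
        exact h3.le.trans (Nat.pow_le_pow_right (by omega) (h d (by simp)))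
      nlinarith [Nat.mul_le_mul_left a.1 h2]

lemma spaced_of {K b : ℕ} {P : List (ℕ × ℕ)} (h1 : ∀ x ∈ P, b + K ≤ x.2)
    (h2 : P.Pairwise fun x y => x.2 + K ≤ y.2) : Spaced K b P := by
  induction P generalizing b with
  | nil => trivial
  | cons x P ih =>
    rw [List.pairwise_cons] at h2
    exact ⟨h1 x (by simp), ih h2.1 h2.2⟩

lemma pl_pairwise (B : List (ℕ × F)) (l : List ℕ) (h : l.Pairwise (· > ·)) :
    (pl B l).Pairwise fun x y => x.2 > y.2 := by
  rw [List.pairwise_iff_getElem] at h ⊢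
  intro i j hi hj hij
  simp only [pl, List.length_zip, List.length_map] at hi hj
  have := h i j (by omega) (by omega) hij
  simp only [pl, List.getElem_zip, List.getElem_map]
  omega

lemma wt_ge (B : List (ℕ × F)) (a : ℕ × F) (h : a ∈ B) : a.1 ≤ (B.map Prod.fst).sum :=
  List.single_le_sum (by simp) _ (List.mem_map_of_mem h)

lemma uniq (q w J K : ℕ) (hq : 2 ≤ q)
    (hK : ((w : ℤ) + 1) * (2 * w + 1 + (q - 1) * J) < (q : ℤ) ^ K)
    (B B' : List (ℕ × F)) (l l' : List ℕ) (j j' : ℕ) (hj : j ≤ J) (hj' : j' ≤ J)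
    (hl : l.length = B.length) (hl' : l'.length = B'.length)
    (hs : l.Pairwise (· > ·)) (hs' : l'.Pairwise (· > ·))
    (hB : (B.map Prod.fst).sum ≤ w) (hB' : (B'.map Prod.fst).sum ≤ w)
    (hBq : ∀ a ∈ B, ¬ q ∣ a.1) (hBq' : ∀ a ∈ B', ¬ q ∣ a.1)
    (hlen : B'.length ≤ B.length) (hsp : Spaced K 0 (pl B l).reverse)
    (heq : ex q B l + j' = ex q B' l' + j) :
    B'.map Prod.fst = B.map Prod.fst ∧ l' = l ∧ j' = j := by
  have hq1 : (1 : ℤ) ≤ (q : ℤ) - 1 := by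
    have : (2 : ℤ) ≤ q := by exact_mod_cast hq
    linarith
  have v1 := val_pl q B l hl
  have v2 := val_pl q B' l' hl'
  have hfst : ∀ (B : List (ℕ × F)) (l : List ℕ), l.length = B.length →
      (pl B l).map Prod.fst = B.map Prod.fst := by
    intro B l h
    rw [pl, List.map_fst_zip]
    simp [h]
  have hsnd : ∀ (B : List (ℕ × F)) (l : List ℕ), l.length = B.length →
      (pl B l).map Prod.snd = l.map (· + 1) := by
    intro B l h
    rw [pl, List.map_snd_zip]
    simp [h]
  have hmemfst : ∀ (B : List (ℕ × F)) (l : List ℕ), l.length = B.length → ∀ x ∈ pl B l,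
      ∃ a ∈ B, a.1 = x.1 := by
    intro B l h x hx
    have : x.1 ∈ (pl B l).map Prod.fst := List.mem_map_of_mem hx
    rw [hfst B l h] at this
    simpa using this
  have heqz : (ex q B l : ℤ) + j' = ex q B' l' + j := by exact_mod_cast heq
  set W := (B.map Prod.fst).sum
  set W' := (B'.map Prod.fst).sum
  have := comb q w K (2 * w + 1 + (q - 1) * J) hq
    (by have : (0 : ℤ) ≤ ((q : ℤ) - 1) * J := by positivity
        linarith) hK (pl B l).reverse 0
    (((q : ℤ) - 1) * (j - j') + (W - W')) (pl B' l') hsp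
    (by
      intro x hx
      obtain ⟨a, ha, h⟩ := hmemfst B l hl x (by simpa using hx)
      rw [← h]
      exact (wt_ge B a ha).trans hB)
    (by
      intro x hx
      obtain ⟨a, ha, h⟩ := hmemfst B l hl x (by simpa using hx)
      rw [← h]
      exact hBq a ha)
    (by
      rw [Multiset.map_coe, Multiset.sum_coe, hfst B' l' hl']
      exact hB')
    (by
      intro x hx
      obtain ⟨a, ha, h⟩ := hmemfst B' l' hl' x (by simpa using hx)
      rw [← h]
      exact hBq' a ha)
    (by
      intro x hx
      have : x.2 ∈ (pl B' l').map Prod.snd := List.mem_map_of_mem (by simpa using hx)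
      rw [hsnd B' l' hl'] at this
      simp only [List.mem_map] at this
      obtain ⟨y, _, hy⟩ := this
      omega)
    (by simp [pl, hl, hl', hlen])
    (by
      have e1 : |(j : ℤ) - j'| ≤ J := by rw [abs_le]; constructor <;> omega
      have e2 : |(W : ℤ) - W'| ≤ w := by rw [abs_le]; constructor <;> omega
      have e3 : |((q : ℤ) - 1) * (j - j')| ≤ (q - 1) * J := by
        rw [abs_mul, abs_of_nonneg (by linarith : (0 : ℤ) ≤ (q : ℤ) - 1)]
        exact mul_le_mul_of_nonneg_left e1 (by linarith)
      have := abs_add_le (((q : ℤ) - 1) * (j - j')) (W - W')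
      simp only [pow_zero, mul_one]
      linarith [Int.natCast_nonneg w])
    (by
      rw [Multiset.coe_reverse, v1, v2]
      linear_combination ((q : ℤ) - 1) * heqz)
  obtain ⟨h1, h2⟩ := this
  rw [Multiset.coe_reverse, Multiset.coe_eq_coe] at h1
  have h3 : pl B' l' = pl B l := by
    refine List.Perm.eq_of_pairwise ?_ (pl_pairwise B' l' hs') (pl_pairwise B l hs) h1
    intro a b _ _ h1 h2
    omega
  have h4 : B'.map Prod.fst = B.map Prod.fst := by rw [← hfst B' l' hl', ← hfst B l hl, h3]
  have h5 : l' = l := by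
    have := hsnd B' l' hl'
    rw [h3, hsnd B l hl] at this
    exact (List.map_injective_iff.2 (add_left_injective 1) this).symm
  refine ⟨h4, h5, ?_⟩
  have h6 : W = W' := by simp only [W, W', h4]
  rw [h6, sub_self, add_zero] at h2
  rcases mul_eq_zero.1 h2 with h | h <;> omega

lemma cf_range (B : List (ℕ × F)) (f : ℕ → ℕ) :
    cf B ((List.range B.length).map f) =
      ∏ i ∈ Finset.range B.length, (B.getD i (0, 0)).2 ^ f i := by
  have : List.zipWith (fun (a : ℕ × F) d => a.2 ^ d) B ((List.range B.length).map f) =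
      (List.range B.length).map fun i => (B.getD i (0, 0)).2 ^ f i := by
    refine List.ext_getElem (by simp) ?_
    intro i h1 h2
    simp at h1
    simp [h1]
  rw [cf, this]
  rfl

/-- Characters as monoid homs. -/
def chiH (n : ℕ) (B : List (ℕ × F)) : Multiplicative (ℕ → ℕ) →* F where
  toFun m := ∏ i ∈ Finset.range n, (B.getD i (0, 0)).2 ^ (Multiplicative.toAdd m i)
  map_one' := by simp
  map_mul' := by
    intro x y
    simp [pow_add, Finset.prod_mul_distrib]

lemma chiH_inj (n : ℕ) (B B' : List (ℕ × F)) (h : B.length = n)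
    (hm : B.map Prod.fst = B'.map Prod.fst) (hc : chiH n B = chiH n B') : B = B' := by
  have hlen : B.length = B'.length := by simpa using congrArg List.length hm
  refine List.ext_getElem hlen ?_
  intro i h1 h2
  refine Prod.ext ?_ ?_
  · have : (B.map Prod.fst)[i]'(by simpa using h1) = (B'.map Prod.fst)[i]'(by simpa using h2) := by
      simp only [hm]
    simpa using this
  · have := DFunLike.congr_fun hc (Multiplicative.ofAdd (Pi.single i 1))
    simp only [chiH, MonoidHom.coe_mk, OneHom.coe_mk, toAdd_ofAdd] at this
    rw [Finset.prod_eq_single i, Finset.prod_eq_single i] at this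
    · simpa [h1, h2] using this
    · intro k _ hk; simp [hk]
    · intro hk; simp at hk; omega
    · intro k _ hk; simp [hk]
    · intro hk; simp at hk; omega

lemma length_le_wt (q : ℕ) (B : List (ℕ × F)) (h : ∀ a ∈ B, ¬ q ∣ a.1) :
    B.length ≤ (B.map Prod.fst).sum := by
  induction B with
  | nil => simp
  | cons a B ih =>
    have h1 := ih fun x hx => h x (by simp [hx])
    have h2 : a.1 ≠ 0 := fun h0 => h a (by simp) (h0 ▸ dvd_zero q)
    simp only [List.length_cons, List.map_cons, List.sum_cons]
    omega

set_option maxHeartbeats 1000000 in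
lemma spec_indep (q N w J : ℕ) (hq : 2 ≤ q) (hN : 0 < N) (I : Finset (List (ℕ × F)))
    (hI : ∀ B ∈ I, (B.map Prod.fst).sum ≤ w ∧ ∀ a ∈ B, ¬ q ∣ a.1 ∧ a.2 ^ N = 1) :
    ∃ T0, ∀ T1 ≥ T0, ∀ η : List (ℕ × F) → ℕ → F,
      (∀ e ≤ w * q ^ T0, ∀ j0 ≤ J, ∑ B ∈ I, ∑ j ∈ Finset.range (J + 1),
        PowerSeries.coeff (e + j) (PowerSeries.X ^ j0 * NS (g2 q) 0 B T1) * η B j = 0) →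
      ∀ B ∈ I, ∀ j ≤ J, η B j = 0 := by
  obtain ⟨K, hK⟩ : ∃ K : ℕ, ((w : ℤ) + 1) * (2 * w + 1 + (q - 1) * J) < (q : ℤ) ^ K := by
    refine pow_unbounded_of_one_lt _ ?_
    exact_mod_cast hq
  refine ⟨(K + N) * w + N, fun T1 hT1 η hη => ?_⟩
  by_contra hcon
  push Not at hcon
  -- choose a word of maximal length
  obtain ⟨B0, hB0, hmax⟩ := Finset.exists_max_image
    (I.filter fun B => ∃ j ≤ J, η B j ≠ 0) List.length
    (by obtain ⟨B, hB, j, hj, h⟩ := hcon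
        exact ⟨B, by simp only [Finset.mem_filter]; exact ⟨hB, j, hj, h⟩⟩)
  rw [Finset.mem_filter] at hB0
  obtain ⟨hB0I, j0, hj0, hne⟩ := hB0
  have hmax' : ∀ B ∈ I, B0.length < B.length → ∀ j ≤ J, η B j = 0 := by
    intro B hB hlt j hj
    by_contra h
    have := hmax B (by simp only [Finset.mem_filter]; exact ⟨hB, j, hj, h⟩)
    omega
  set n := B0.length with hn
  have hnw : n ≤ w := (length_le_wt q B0 fun a ha => ((hI B0 hB0I).2 a ha).1).trans (hI B0 hB0I).1
  let cc : ℕ → ℕ := fun i => (K + N) * (n - i) - 1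
  let I' := I.filter fun B => B.map Prod.fst = B0.map Prod.fst
  have hI'len : ∀ B ∈ I', B.length = n := by
    intro B hB
    have := congrArg List.length (Finset.mem_filter.1 hB).2
    simpa using this
  -- the basic identity
  have key : ∀ m : ℕ → ℕ, (∀ i, m i < N) →
      ∑ B ∈ I', η B j0 * cf B ((List.range n).map fun i => cc i + m i) = 0 := by
    intro m hm
    set l0 := (List.range n).map fun i => cc i + m i with hl0
    have hl0len : l0.length = B0.length := by simp [hl0, hn]
    have hstep : ∀ i, i < n → (K + N) * (n - i) = cc i + 1 := by
      intro i hi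
      have : 1 ≤ (K + N) * (n - i) := Nat.mul_pos (by omega) (by omega)
      simp only [cc]; omega
    have hstep2 : ∀ i k, i < k → k < n → cc k + (K + N) ≤ cc i := by
      intro i k hik hk
      have h1 := hstep i (by omega)
      have h2 := hstep k hk
      have : (K + N) * (n - k) + (K + N) ≤ (K + N) * (n - i) := by
        rw [← Nat.mul_succ]; exact Nat.mul_le_mul_left _ (by omega)
      omega
    have hl0gap : l0.Pairwise fun x y => y + K < x := by
      rw [List.pairwise_iff_getElem]
      intro i k hi hk hik
      simp only [hl0, List.length_map, List.length_range] at hi hk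
      simp only [hl0, List.getElem_map, List.getElem_range]
      have := hstep2 i k hik hk
      have := hm k
      omega
    have hl0s : l0.Pairwise (· > ·) := hl0gap.imp (by intro a b h; omega)
    have hl0T : ∀ x ∈ l0, x < (K + N) * w + N := by
      intro x hx
      simp only [hl0, List.mem_map, List.mem_range] at hx
      obtain ⟨i, hi, rfl⟩ := hx
      have := hstep i hi
      have : (K + N) * (n - i) ≤ (K + N) * w := Nat.mul_le_mul_left _ (by omega)
      have := hm i
      omega
    have hsp : Spaced K 0 (pl B0 l0).reverse := by
      refine spaced_of ?_ ?_
      · intro x hx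
        rw [List.mem_reverse, pl] at hx
        have hx2 := (List.of_mem_zip (a := x.1) (b := x.2) hx).2
        simp only [hl0, List.mem_map, List.mem_range] at hx2
        obtain ⟨y, ⟨i, hi, rfl⟩, hy⟩ := hx2
        have := hstep i hi
        have : (K + N) * 1 ≤ (K + N) * (n - i) := Nat.mul_le_mul_left _ (by omega)
        omega
      · rw [List.pairwise_reverse, List.pairwise_iff_getElem]
        intro i k hi hk hik
        simp only [pl, List.length_zip, List.length_map] at hi hk
        have := (List.pairwise_iff_getElem.1 hl0gap) i k (by omega) (by omega) hik
        simp only [pl, List.getElem_zip, List.getElem_map]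
        omega
    have h0 := hη (ex q B0 l0)
      ((ex_le q _ hq B0 l0 hl0T).trans (Nat.mul_le_mul_right _ (hI B0 hB0I).1)) j0 hj0
    have hterm : ∀ B ∈ I, ∑ j ∈ Finset.range (J + 1),
        PowerSeries.coeff (ex q B0 l0 + j) (PowerSeries.X ^ j0 * NS (g2 q) 0 B T1) * η B j =
        if B.map Prod.fst = B0.map Prod.fst then sg F (B0.map Prod.fst) l0 * (η B j0 * cf B l0)
        else 0 := by
      intro B hB
      by_cases hlt : n < B.length
      · rw [Finset.sum_eq_zero, if_neg]
        · intro h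
          have := congrArg List.length h
          simp at this
          omega
        · intro j hj
          rw [hmax' B hB hlt j (by simp at hj; omega), mul_zero]
      have hcoef : ∀ j, PowerSeries.coeff (ex q B0 l0 + j) (PowerSeries.X ^ j0 * NS (g2 q) 0 B T1)
          = ∑ l ∈ Dec B.length T1, if ex q B0 l0 + j = ex q B l + j0 then
            sg F (B.map Prod.fst) l * cf B l else 0 := by
        intro j
        rw [NS_eq_sum, Finset.mul_sum, map_sum]
        refine Finset.sum_congr rfl fun l _ => ?_
        rw [prod_g2, mul_left_comm, ← pow_add, PowerSeries.coeff_C_mul, PowerSeries.coeff_X_pow,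
          add_comm j0]
        split_ifs <;> simp
      simp only [hcoef]
      have huniq : ∀ j ≤ J, ∀ l ∈ Dec B.length T1, ex q B0 l0 + j = ex q B l + j0 →
          B.map Prod.fst = B0.map Prod.fst ∧ l = l0 ∧ j = j0 := by
        intro j hj l hl he
        rw [mem_Dec] at hl
        exact uniq q w J K hq hK B0 B l0 l j0 j hj0 hj hl0len hl.1 hl0s hl.2.1 (hI B0 hB0I).1
          (hI B hB).1 (fun a ha => ((hI B0 hB0I).2 a ha).1) (fun a ha => ((hI B hB).2 a ha).1)
          (by omega) hsp he
      split_ifs with hfst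
      · have hBlen : B.length = n := by simpa using congrArg List.length hfst
        have hexeq : ex q B l0 = ex q B0 l0 := by
          have hcomm : ∀ B : List (ℕ × F), ex q B l0 =
              (List.zipWith (fun (s d : ℕ) => s * ∑ i ∈ Finset.range (d + 1), q ^ i)
                (B.map Prod.fst) l0).sum := by
            intro B
            rw [ex, List.zipWith_map_left]
          rw [hcomm, hcomm, hfst]
        rw [Finset.sum_eq_single j0]
        · rw [Finset.sum_eq_single l0]
          · rw [if_pos (by rw [hexeq]), hfst]; ring
          · intro l hl hne
            rw [if_neg]
            intro h
            exact hne (huniq j0 hj0 l hl h).2.1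
          · intro h
            refine absurd ?_ h
            rw [mem_Dec]
            exact ⟨by rw [hl0len, hBlen], hl0s, fun x hx => (hl0T x hx).trans_le hT1⟩
        · intro j hj hne
          rw [Finset.sum_eq_zero, zero_mul]
          intro l hl
          rw [if_neg]
          intro h
          exact hne (huniq j (by simp at hj; omega) l hl h).2.2
        · intro h; simp at h; omega
      · refine Finset.sum_eq_zero fun j hj => ?_
        rw [Finset.sum_eq_zero, zero_mul]
        intro l hl
        rw [if_neg]
        intro h
        exact hfst (huniq j (by simp at hj; omega) l hl h).1
    rw [Finset.sum_congr rfl hterm, ← Finset.sum_filter, ← Finset.mul_sum] at h0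
    exact (mul_eq_zero.1 h0).resolve_left (sg_ne _ _)
  -- Dedekind
  have hroot : ∀ B ∈ I', ∀ i ∈ Finset.range n, (B.getD i (0, 0)).2 ^ N = 1 := by
    intro B hB i hi
    have hlen := hI'len B hB
    have hi' : i < B.length := by simp at hi; omega
    rw [List.getD_eq_getElem _ _ hi']
    exact ((hI B (Finset.mem_filter.1 hB).1).2 _ (List.getElem_mem hi')).2
  have key2 : ∀ m : ℕ → ℕ, ∑ B ∈ I', (η B j0 * ∏ i ∈ Finset.range n, (B.getD i (0, 0)).2 ^ cc i) *
      chiH n B (Multiplicative.ofAdd m) = 0 := by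
    intro m
    refine Eq.trans ?_ (key (fun i => m i % N) (fun i => Nat.mod_lt _ hN))
    refine Finset.sum_congr rfl fun B hB => ?_
    have := hI'len B hB
    rw [← this, cf_range, this, mul_assoc]
    congr 1
    simp only [chiH, MonoidHom.coe_mk, OneHom.coe_mk, toAdd_ofAdd]
    rw [← Finset.prod_mul_distrib]
    refine Finset.prod_congr rfl fun i hi => ?_
    rw [pow_add]
    congr 1
    conv_lhs => rw [← Nat.mod_add_div (m i) N, pow_add, pow_mul, hroot B hB i hi, one_pow, mul_one]
  have hli := (linearIndependent_monoidHom (Multiplicative (ℕ → ℕ)) F).comp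
    (fun B : I' => chiH n B.1) (by
      intro B B' h
      refine Subtype.ext (chiH_inj n B.1 B'.1 (hI'len _ B.2) ?_ h)
      rw [(Finset.mem_filter.1 B.2).2, (Finset.mem_filter.1 B'.2).2])
  rw [Fintype.linearIndependent_iff] at hli
  have hz := hli (fun B => η B.1 j0 * ∏ i ∈ Finset.range n, (B.1.getD i (0, 0)).2 ^ cc i) (by
    funext m
    have := key2 (Multiplicative.toAdd m)
    rw [← Finset.sum_coe_sort] at this
    simpa [Finset.sum_apply] using this) ⟨B0, Finset.mem_filter.2 ⟨hB0I, rfl⟩⟩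
  rcases mul_eq_zero.1 hz with h | h
  · exact hne h
  · rw [Finset.prod_eq_zero_iff] at h
    obtain ⟨i, hi, h⟩ := h
    have h1 := hroot B0 (Finset.mem_filter.2 ⟨hB0I, rfl⟩) i hi
    have h2 : (B0.getD i (0, 0)).2 = 0 := by
      simp only at h
      by_contra hh
      exact pow_ne_zero _ hh h
    rw [h2, zero_pow hN.ne'] at h1
    exact zero_ne_one h1

end Spec

/-! ### The subring of pairs -/

section Pairs

variable {F : Type} [Field F]

/-- Pairs of power series with sparse supports which agree to first order. -/
def GP (F : Type) [Field F] (Q : ℕ) : Subring (PowerSeries F × PowerSeries F) where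
  carrier := {p | (∀ n, PowerSeries.coeff n p.1 ≠ 0 → ∃ i a, a ≤ i ∧ n + a = i * Q) ∧
    ∀ i, i + 1 < Q → PowerSeries.coeff (i * Q) p.1 = PowerSeries.coeff i p.2}
  zero_mem' := by simp
  one_mem' := by
    constructor
    · intro n hn
      refine ⟨0, 0, le_rfl, ?_⟩
      by_contra h
      apply hn
      simp only [Prod.fst_one, PowerSeries.coeff_one]
      rw [if_neg]
      omega
    · intro i hi
      simp only [Prod.fst_one, Prod.snd_one, PowerSeries.coeff_one]
      have : i * Q = 0 ↔ i = 0 := by simp; omega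
      simp only [this]
  add_mem' := by
    rintro p r ⟨h1, h2⟩ ⟨h3, h4⟩
    constructor
    · intro n hn
      by_cases h : PowerSeries.coeff n p.1 = 0
      · refine h3 n fun h' => hn ?_
        simp [h, h']
      · exact h1 n h
    · intro i hi
      simp [h2 i hi, h4 i hi]
  neg_mem' := by
    rintro p ⟨h1, h2⟩
    exact ⟨fun n hn => h1 n fun h => hn (by simp [h]), fun i hi => by simp [h2 i hi]⟩
  mul_mem' := by
    rintro p r ⟨h1, h2⟩ ⟨h3, h4⟩
    constructor
    · intro n hn
      simp only [Prod.fst_mul, PowerSeries.coeff_mul] at hn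
      obtain ⟨x, hx, hne⟩ := Finset.exists_ne_zero_of_sum_ne_zero hn
      obtain ⟨i, a, hia, e1⟩ := h1 x.1 (left_ne_zero_of_mul hne)
      obtain ⟨j, b, hjb, e2⟩ := h3 x.2 (right_ne_zero_of_mul hne)
      rw [Finset.HasAntidiagonal.mem_antidiagonal] at hx
      exact ⟨i + j, a + b, by omega, by rw [add_mul]; omega⟩
    · intro i hi
      simp only [Prod.fst_mul, Prod.snd_mul, PowerSeries.coeff_mul]
      symm
      refine Finset.sum_of_injOn (fun x => (x.1 * Q, x.2 * Q)) ?_ ?_ ?_ ?_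
      · intro x _ y _ hxy
        have hQ : 0 < Q := by omega
        simp only [Prod.mk.injEq] at hxy
        exact Prod.ext (Nat.eq_of_mul_eq_mul_right hQ hxy.1) (Nat.eq_of_mul_eq_mul_right hQ hxy.2)
      · intro x hx
        simp only [Finset.mem_coe, Finset.HasAntidiagonal.mem_antidiagonal] at hx ⊢
        rw [← hx, add_mul]
      · intro x hx hx'
        rw [Finset.HasAntidiagonal.mem_antidiagonal] at hx
        by_contra hne
        obtain ⟨i1, a, hia, e1⟩ := h1 x.1 (left_ne_zero_of_mul hne)
        obtain ⟨i2, b, hjb, e2⟩ := h3 x.2 (right_ne_zero_of_mul hne)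
        have e3 : i * Q + (a + b) = (i1 + i2) * Q := by rw [add_mul]; omega
        have hle : i ≤ i1 + i2 := by
          by_contra hlt
          have : (i1 + i2 + 1) * Q ≤ i * Q := Nat.mul_le_mul_right _ (by omega)
          rw [add_mul] at this
          omega
        obtain ⟨c, hc⟩ := Nat.exists_eq_add_of_le hle
        have e4 : a + b = c * Q := by
          rw [hc, add_mul] at e3
          omega
        have hc0 : c = 0 := by
          rcases Nat.eq_zero_or_pos c with h | h
          · exact h
          · exfalso
            obtain ⟨c', rfl⟩ : ∃ c', c = c' + 1 := ⟨c - 1, by omega⟩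
            have : c' * 1 ≤ c' * Q := Nat.mul_le_mul_left _ (by omega)
            rw [add_mul] at e4
            omega
        subst hc0
        simp at e4
        obtain ⟨rfl, rfl⟩ := e4
        apply hx'
        simp only [Set.mem_image, Finset.mem_coe, Finset.HasAntidiagonal.mem_antidiagonal]
        exact ⟨(i1, i2), by simpa using hc, Prod.ext (by simpa using e1.symm) (by simpa using e2.symm)⟩
      · intro x hx
        rw [Finset.HasAntidiagonal.mem_antidiagonal] at hx
        simp only
        rw [h2 x.1 (by omega), h4 x.2 (by omega)]

/-- The expansion of `1/(θ - θ^P)`. -/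
def EP (F : Type) [Field F] (P : ℕ) : PowerSeries F :=
  PowerSeries.mk fun n => if ∃ m, n = P + m * (P - 1) then -1 else 0

lemma EP_eq (P : ℕ) (hP : 2 ≤ P) :
    EP F P * (PowerSeries.X ^ (P - 1) - 1) = PowerSeries.X ^ P := by
  ext n
  rw [mul_sub, mul_one, map_sub, PowerSeries.coeff_mul_X_pow', PowerSeries.coeff_X_pow]
  simp only [EP, PowerSeries.coeff_mk]
  by_cases h : ∃ m, n = P + m * (P - 1)
  · obtain ⟨m, hm⟩ := h
    rw [if_pos (⟨m, hm⟩ : ∃ m, n = P + m * (P - 1))]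
    rcases Nat.eq_zero_or_pos m with h0 | h0
    · subst h0
      simp only [zero_mul, add_zero] at hm
      subst hm
      rw [if_pos (by omega), if_neg]
      · simp
      · rintro ⟨m, hm⟩
        omega
    · obtain ⟨m', rfl⟩ : ∃ m', m = m' + 1 := ⟨m - 1, by omega⟩
      rw [add_mul] at hm
      rw [if_pos (by omega), if_pos ⟨m', by omega⟩, if_neg (by omega)]
      simp
  · rw [if_neg h, if_neg (c := n = P)]
    · split_ifs with h1 h2
      · exfalso
        obtain ⟨m, hm⟩ := h2
        exact h ⟨m + 1, by rw [add_mul]; omega⟩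
      · simp
      · simp
    · rintro rfl
      exact h ⟨0, by simp⟩

lemma EP_mem (q Q l : ℕ) (hq : 1 ≤ q) (hQ : 2 ≤ Q) :
    (EP F (Q * q ^ l), -(PowerSeries.X ^ (q ^ l))) ∈ GP F Q := by
  have hql : 1 ≤ q ^ l := Nat.one_le_pow _ _ hq
  set t := q ^ l
  have hP : 2 ≤ Q * t := by nlinarith
  have key : ∀ m, Q * t + m * (Q * t - 1) + m = (m + 1) * t * Q := by
    intro m
    obtain ⟨P', hP'⟩ : ∃ P', Q * t = P' + 1 := ⟨Q * t - 1, by omega⟩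
    have : (m + 1) * t * Q = (m + 1) * (Q * t) := by ring
    rw [this, hP']
    simp
    ring
  constructor
  · intro n hn
    simp only [EP, PowerSeries.coeff_mk, ne_eq, ite_eq_right_iff, Classical.not_imp] at hn
    obtain ⟨⟨m, rfl⟩, _⟩ := hn
    exact ⟨(m + 1) * t, m, by nlinarith, key m⟩
  · intro i hi
    simp only [EP, PowerSeries.coeff_mk, map_neg, PowerSeries.coeff_X_pow]
    have : (∃ m, i * Q = Q * t + m * (Q * t - 1)) ↔ i = t := by
      constructor
      · rintro ⟨m, hm⟩
        have h1 := key m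
        rw [← hm] at h1
        have hd : Q ∣ m := by
          rw [← Nat.dvd_add_right (Dvd.intro_left i rfl : Q ∣ i * Q), h1]
          exact Dvd.intro_left _ rfl
        obtain ⟨c, rfl⟩ := hd
        rcases Nat.eq_zero_or_pos c with h0 | h0
        · subst h0
          simp at h1
          rcases h1 with h | h <;> omega
        · exfalso
          have h2 : i + c = (Q * c + 1) * t := by
            refine Nat.eq_of_mul_eq_mul_right (by omega : 0 < Q) ?_
            rw [← h1]; ring
          have h3 : Q * c + 1 ≤ (Q * c + 1) * t := Nat.le_mul_of_pos_right _ hql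
          obtain ⟨c', rfl⟩ : ∃ c', c = c' + 1 := ⟨c - 1, by omega⟩
          have h4 : 1 * c' ≤ Q * c' := Nat.mul_le_mul_right _ (by omega)
          rw [← h2, mul_add] at h3
          omega
      · rintro rfl
        exact ⟨0, by ring⟩
    simp only [this]
    split_ifs <;> simp

lemma C_mem (Q : ℕ) (c : F) : (PowerSeries.C c, PowerSeries.C c) ∈ GP F Q := by
  constructor
  · intro n hn
    refine ⟨0, 0, le_rfl, ?_⟩
    by_contra h
    apply hn
    simp only [PowerSeries.coeff_C]
    rw [if_neg]
    omega
  · intro i hi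
    simp only [PowerSeries.coeff_C]
    have : i * Q = 0 ↔ i = 0 := by simp; omega
    simp only [this]

/-- Summand of the series `H`. -/
def gH (q Q : ℕ) (a : ℕ × F) (d : ℕ) : PowerSeries F :=
  PowerSeries.C (a.2 ^ d) * (∏ l ∈ Finset.range (d + 1), EP F (Q * q ^ l)) ^ a.1

lemma gH_mem (q Q : ℕ) (hq : 1 ≤ q) (hQ : 2 ≤ Q) (a : ℕ × F) (d : ℕ) :
    (gH q Q a d, g2 q a d) ∈ GP F Q := by
  have h1 := C_mem (F := F) Q (a.2 ^ d)
  have h2 : ∏ l ∈ Finset.range (d + 1), ((EP F (Q * q ^ l), -(PowerSeries.X ^ (q ^ l))) :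
      PowerSeries F × PowerSeries F) ∈ GP F Q :=
    Subring.prod_mem _ fun l _ => EP_mem q Q l hq hQ
  have h3 := mul_mem h1 (pow_mem h2 a.1)
  convert h3 using 1
  refine Prod.ext ?_ ?_
  · simp [gH, Prod.fst_prod]
  · simp [g2, Prod.snd_prod]

lemma NS_mem {α R : Type} [CommRing R] (G : Subring R) (g : α → ℕ → R) (h : ∀ a d, g a d ∈ G)
    (lo : ℕ) (w : List α) (hi : ℕ) : NS g lo w hi ∈ G := by
  induction w generalizing hi with
  | nil => exact one_mem G
  | cons a w ih =>
    rw [NS_cons]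
    exact sum_mem fun d _ => mul_mem (h a d) (ih d)

lemma NSH_mem (q Q : ℕ) (hq : 1 ≤ q) (hQ : 2 ≤ Q) (B : List (ℕ × F)) (T : ℕ) :
    (NS (gH q Q) 0 B T, NS (g2 q) 0 B T) ∈ GP F Q := by
  have h := NS_mem (GP F Q) (fun a d => (gH q Q a d, g2 q a d)) (gH_mem q Q hq hQ) 0 B T
  convert h using 1
  refine Prod.ext ?_ ?_
  · exact (NS_map (RingHom.fst (PowerSeries F) (PowerSeries F))
      (fun a d => (gH q Q a d, g2 q a d)) 0 B T).symm
  · exact (NS_map (RingHom.snd (PowerSeries F) (PowerSeries F))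
      (fun a d => (gH q Q a d, g2 q a d)) 0 B T).symm

end Pairs

/-! ### Laurent series and coefficient extraction -/

section Extract

variable {F : Type} [Field F]

/-- The element `θ`. -/
def th (F : Type) [Field F] : LaurentSeries F := HahnSeries.single (-1 : ℤ) 1

/-- Evaluation of polynomials at `θ`. -/
def iota (F : Type) [Field F] : Polynomial F →+* LaurentSeries F :=
  Polynomial.eval₂RingHom HahnSeries.C (th F)

lemma iota_C (c : F) : iota F (Polynomial.C c) = HahnSeries.C c := by
  simp [iota]

lemma iota_X : iota F Polynomial.X = th F := by
  simp [iota]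

lemma th_pow (n : ℕ) : th F ^ n = HahnSeries.single (-(n : ℤ)) 1 := by
  rw [th, HahnSeries.single_pow]
  simp

lemma coeff_mul_iota (f : LaurentSeries F) (p : Polynomial F) (n : ℤ) (L : ℕ)
    (h : p.natDegree < L) :
    (f * iota F p).coeff n = ∑ m ∈ Finset.range L, f.coeff (n + m) * p.coeff m := by
  have h1 : iota F p = ∑ m ∈ Finset.range L, HahnSeries.single (-(m : ℤ)) (p.coeff m) := by
    rw [iota, Polynomial.coe_eval₂RingHom, Polynomial.eval₂_eq_sum_range' _ h]
    refine Finset.sum_congr rfl fun m _ => ?_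
    rw [th_pow, HahnSeries.C_mul_eq_smul]
    ext k
    simp [HahnSeries.coeff_single]
  rw [h1, Finset.mul_sum, HahnSeries.coeff_sum]
  refine Finset.sum_congr rfl fun m _ => ?_
  rw [HahnSeries.coeff_mul_single, sub_neg_eq_add]

/-- Order at least `n`. -/
def Ord (n : ℤ) (f : LaurentSeries F) : Prop := ∀ m < n, f.coeff m = 0

lemma Ord.mul {a b : ℤ} {f g : LaurentSeries F} (hf : Ord a f) (hg : Ord b g) :
    Ord (a + b) (f * g) := by
  intro m hm
  rw [HahnSeries.coeff_mul]
  refine Finset.sum_eq_zero fun x hx => ?_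
  rw [Finset.mem_antidiagonal] at hx
  by_cases h : x.1 < a
  · rw [hf _ h, zero_mul]
  · rw [hg _ (by omega), mul_zero]

lemma Ord.mono {a b : ℤ} {f : LaurentSeries F} (hf : Ord a f) (h : b ≤ a) : Ord b f :=
  fun m hm => hf m (by omega)

lemma Ord.sum {ι : Type} {s : Finset ι} {a : ℤ} {f : ι → LaurentSeries F}
    (h : ∀ i ∈ s, Ord a (f i)) : Ord a (∑ i ∈ s, f i) := by
  intro m hm
  rw [HahnSeries.coeff_sum]
  exact Finset.sum_eq_zero fun i hi => h i hi m hm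

lemma Ord.neg {a : ℤ} {f : LaurentSeries F} (hf : Ord a f) : Ord a (-f) := by
  intro m hm
  rw [HahnSeries.coeff_neg, hf m hm, neg_zero]

lemma Ord.one : Ord 0 (1 : LaurentSeries F) := by
  intro m hm
  rw [HahnSeries.coeff_one, if_neg (by omega)]

lemma Ord.pow {a : ℤ} {f : LaurentSeries F} (hf : Ord a f) (n : ℕ) : Ord (n * a) (f ^ n) := by
  induction n with
  | zero => simpa using Ord.one
  | succ n ih =>
    rw [pow_succ]
    exact (ih.mul hf).mono (by push_cast; linarith)

lemma Ord.iota {p : Polynomial F} {d : ℕ} (h : p.natDegree ≤ d) : Ord (-(d : ℤ)) (iota F p) := by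
  intro m hm
  rw [← one_mul (ZHPC.iota F p), coeff_mul_iota 1 p m (d + 1) (by omega)]
  refine Finset.sum_eq_zero fun k hk => ?_
  rw [Finset.mem_range] at hk
  rw [HahnSeries.coeff_one, if_neg (by omega), zero_mul]

lemma extract {β : Type} (Q J M : ℕ) (hQ : J + M + 1 < Q) (I : Finset β)
    (H H0 : β → PowerSeries F) (hH : ∀ b ∈ I, (H b, H0 b) ∈ GP F Q) (Z : β → Polynomial F)
    (hdeg : ∀ b ∈ I, (Z b).natDegree < (J + 1) * Q)
    (v0 : ℕ)
    (hZ : ∀ b ∈ I, ∀ j ≤ J, ∀ r < Q, (Z b).coeff (j * Q + r) ≠ 0 →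
      v0 ≤ r ∧ r + (J + M + 1) < Q) (hv0 : v0 < Q)
    (hrel : Ord ((M : ℤ) * Q + 1)
      (∑ b ∈ I, HahnSeries.ofPowerSeries ℤ F (H b) * iota F (Z b)))
    (e : ℕ) (he : e ≤ M) (j0 : ℕ) (hj0 : j0 ≤ J) :
    ∑ b ∈ I, ∑ j ∈ Finset.range (J + 1),
        PowerSeries.coeff (e + j) (PowerSeries.X ^ j0 * H0 b) * (Z b).coeff (j * Q + v0) = 0 := by
  set n : ℤ := (e : ℤ) * Q - j0 * Q - v0 with hn
  have h0 := hrel n (by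
    have : (e : ℤ) * Q ≤ M * Q := mul_le_mul_of_nonneg_right (by exact_mod_cast he) (by positivity)
    have : (0 : ℤ) ≤ j0 * Q := by positivity
    omega)
  rw [HahnSeries.coeff_sum] at h0
  rw [← h0]
  refine Finset.sum_congr rfl fun b hb => ?_
  rw [coeff_mul_iota _ _ _ _ (hdeg b hb)]
  obtain ⟨hG1, hG2⟩ := hH b hb
  simp only at hG1 hG2
  refine Finset.sum_of_injOn (fun j => j * Q + v0) ?_ ?_ ?_ ?_
  · intro x _ y _ hxy
    simp only [add_left_inj] at hxy
    exact Nat.eq_of_mul_eq_mul_right (by omega) hxy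
  · intro j hj
    simp only [Finset.coe_range, Set.mem_Iio] at hj ⊢
    have : (j + 1) * Q ≤ (J + 1) * Q := Nat.mul_le_mul_right _ (by omega)
    rw [add_mul] at this
    omega
  · intro m hm hm'
    rw [Finset.mem_range] at hm
    by_contra hne
    set j := m / Q with hj
    set r := m % Q with hr
    have hmjr : m = j * Q + r := by rw [hj, hr, mul_comm]; exact (Nat.div_add_mod m Q).symm
    have hrQ : r < Q := Nat.mod_lt _ (by omega)
    have hjJ : j ≤ J := by
      have : j < J + 1 := Nat.div_lt_of_lt_mul (by rw [mul_comm]; exact hm)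
      omega
    have hz := right_ne_zero_of_mul hne
    rw [hmjr] at hz
    obtain ⟨hr1, hr2⟩ := hZ b hb j hjJ r hrQ hz
    have hh := left_ne_zero_of_mul hne
    rw [PowerSeries.coeff_coe] at hh
    split_ifs at hh with ht
    · exact hh rfl
    obtain ⟨i, a, hai, hia⟩ := hG1 _ hh
    have hia' : n + m + a = i * Q := by
      rw [← Int.natAbs_of_nonneg (not_lt.1 ht)]
      exact_mod_cast hia
    -- δ
    have hd : (r : ℤ) - v0 + a = ((i : ℤ) + j0 - e - j) * Q := by
      rw [hmjr] at hia'
      push_cast at hia'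
      rw [hn] at hia'
      linear_combination hia'
    set δ : ℤ := (i : ℤ) + j0 - e - j with hδ
    have hQpos : (0 : ℤ) < Q := by omega
    have hδ0 : 0 ≤ δ := by
      by_contra hlt
      have : δ * Q < 0 := mul_neg_of_neg_of_pos (by omega) hQpos
      omega
    rcases hδ0.eq_or_lt with h | h
    · rw [← h, zero_mul] at hd
      apply hm'
      simp only [Finset.coe_range, Set.mem_image, Set.mem_Iio]
      exact ⟨j, by omega, by omega⟩
    · obtain ⟨δ', hδ'⟩ : ∃ δ' : ℕ, δ = δ' + 1 := ⟨(δ - 1).toNat, by omega⟩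
      have h3 : (δ' : ℤ) * 1 ≤ δ' * Q := mul_le_mul_of_nonneg_left (by omega) (by positivity)
      rw [hδ', add_mul] at hd
      omega
  · intro j hj
    rw [Finset.mem_range] at hj
    congr 1
    rw [PowerSeries.coeff_X_pow_mul', PowerSeries.coeff_coe]
    have hnm : n + ((j * Q + v0 : ℕ) : ℤ) = ((e : ℤ) + j - j0) * Q := by
      rw [hn]; push_cast; ring
    rw [hnm]
    by_cases h : j0 ≤ e + j
    · have h1 : ((e : ℤ) + j - j0) * Q = ((e + j - j0) * Q : ℕ) := by
        push_cast [h]; ring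
      rw [if_pos h, h1, if_neg (by omega), Int.natAbs_natCast, hG2 _ (by omega)]
    · rw [if_neg h, if_pos]
      exact mul_neg_of_neg_of_pos (by omega) (by omega)

lemma exists_g {β : Type} (Q J c0 : ℕ) (I : Finset β) (Y : β → Polynomial F)
    (hQ : I.card * ((J + 1) * c0) < Q) :
    ∃ g : Polynomial F, g ≠ 0 ∧ g.natDegree < Q ∧ ∀ b ∈ I, ∀ j ≤ J, ∀ r < c0,
      (g * Y b).coeff (j * Q + (Q - c0 + r)) = 0 := by
  let f : Polynomial.degreeLT F Q →ₗ[F] (I × Fin (J + 1) × Fin c0 → F) :=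
    LinearMap.pi fun x =>
      (Polynomial.lcoeff F ((x.2.1 : ℕ) * Q + (Q - c0 + x.2.2))) ∘ₗ
        (LinearMap.mulRight F (Y x.1.1)) ∘ₗ (Polynomial.degreeLT F Q).subtype
  have hfd : FiniteDimensional F (Polynomial.degreeLT F Q) :=
    (Polynomial.degreeLTEquiv F Q).symm.finiteDimensional
  have hk : LinearMap.ker f ≠ ⊥ := by
    apply LinearMap.ker_ne_bot_of_finrank_lt
    rw [(Polynomial.degreeLTEquiv F Q).finrank_eq]
    simpa using hQ
  obtain ⟨g, hg, hg0⟩ := Submodule.exists_mem_ne_zero_of_ne_bot hk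
  have hg0' : g.1 ≠ 0 := fun h => hg0 (Subtype.ext h)
  refine ⟨g.1, hg0', ?_, ?_⟩
  · have := Polynomial.mem_degreeLT.1 g.2
    exact (Polynomial.natDegree_lt_iff_degree_lt hg0').2 this
  · intro b hb j hj r hr
    have := congrFun (LinearMap.mem_ker.1 hg) (⟨b, hb⟩, ⟨j, by omega⟩, ⟨r, hr⟩)
    simpa [f] using this

end Extract

/-! ### The splitting identity -/

section Core

variable {F : Type} [Field F]

/-- `ℓ_d`. -/
def ellG (F : Type) [Field F] (q d : ℕ) : LaurentSeries F :=
  ∏ i ∈ Finset.Icc 1 d, (th F - th F ^ q ^ i)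

/-- Summand of `Li`. -/
def gL (q : ℕ) (a : ℕ × F) (d : ℕ) : LaurentSeries F := HahnSeries.C (a.2 ^ d) / ellG F q d ^ a.1

/-- Polynomial summand. -/
def gP (q D : ℕ) (a : ℕ × F) (d : ℕ) : Polynomial F :=
  Polynomial.C (a.2 ^ d) *
    (∏ i ∈ Finset.Ioc d D, (Polynomial.X - Polynomial.X ^ q ^ i)) ^ a.1

lemma EP_inv (P : ℕ) (hP : 2 ≤ P) :
    HahnSeries.ofPowerSeries ℤ F (EP F P) * (th F - th F ^ P) = 1 := by
  have h1 : th F ^ P * HahnSeries.ofPowerSeries ℤ F (PowerSeries.X ^ (P - 1)) = th F := by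
    rw [th_pow, HahnSeries.ofPowerSeries_X_pow, HahnSeries.single_mul_single, th]
    congr 1
    · push_cast [show 1 ≤ P by omega]; ring
    · simp
  have h2 : th F ^ P * HahnSeries.ofPowerSeries ℤ F (PowerSeries.X ^ P) = 1 := by
    rw [th_pow, HahnSeries.ofPowerSeries_X_pow, HahnSeries.single_mul_single]
    simp
  have h3 := congrArg (HahnSeries.ofPowerSeries ℤ F) (EP_eq (F := F) P hP)
  rw [map_mul, map_sub, map_one] at h3
  calc _ = th F ^ P * (HahnSeries.ofPowerSeries ℤ F (EP F P) *
        (HahnSeries.ofPowerSeries ℤ F (PowerSeries.X ^ (P - 1)) - 1)) := by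
        linear_combination (-HahnSeries.ofPowerSeries ℤ F (EP F P)) * h1
    _ = 1 := by rw [h3, h2]

lemma two_le_pow {q i : ℕ} (hq : 2 ≤ q) (hi : 1 ≤ i) : 2 ≤ q ^ i :=
  hq.trans (Nat.le_self_pow (by omega) q)

lemma fac_ne (P : ℕ) (hP : 2 ≤ P) : th F - th F ^ P ≠ 0 :=
  right_ne_zero_of_mul_eq_one (EP_inv P hP)

lemma ellG_ne (q : ℕ) (hq : 2 ≤ q) (d : ℕ) : ellG F q d ≠ 0 := by
  rw [ellG, Finset.prod_ne_zero_iff]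
  intro i hi
  rw [Finset.mem_Icc] at hi
  exact fac_ne _ (two_le_pow hq hi.1)

lemma ellG_split (q d D : ℕ) (h : d ≤ D) :
    ellG F q D = ellG F q d * ∏ i ∈ Finset.Ioc d D, (th F - th F ^ q ^ i) := by
  have h1 : ∀ k, Finset.Icc 1 k = Finset.Ioc 0 k := by intro k; ext; simp; omega
  rw [ellG, ellG, h1, h1, Finset.prod_Ioc_consecutive _ (Nat.zero_le d) h]

lemma low (q : ℕ) (hq : 2 ≤ q) (D d : ℕ) (h : d ≤ D) (a : ℕ × F) :
    ellG F q D ^ a.1 * gL q a d = iota F (gP q D a d) := by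
  have h1 := ellG_ne (F := F) q hq d
  rw [ellG_split q d D h, gL, gP]
  simp only [map_mul, map_pow, map_prod, map_sub, iota_X, iota_C]
  generalize (∏ i ∈ Finset.Ioc d D, (th F - th F ^ q ^ i)) = y
  rw [mul_pow]
  field_simp

lemma high (q : ℕ) (hq : 2 ≤ q) (D d : ℕ) (a : ℕ × F) :
    ellG F q D ^ a.1 * gL q a (d + (D + 1)) =
      HahnSeries.C (a.2 ^ (D + 1)) * HahnSeries.ofPowerSeries ℤ F (gH q (q ^ (D + 1)) a d) := by
  have h1 := ellG_ne (F := F) q hq D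
  have h2 : Finset.Ioc D (d + (D + 1)) = Finset.Ico (D + 1) (d + (D + 1) + 1) := by
    ext i
    rw [Finset.mem_Ioc, Finset.mem_Ico]
    omega
  have h3 : ∏ i ∈ Finset.Ioc D (d + (D + 1)), (th F - th F ^ q ^ i) =
      ∏ l ∈ Finset.range (d + 1), (th F - th F ^ (q ^ (D + 1) * q ^ l)) := by
    rw [h2, Finset.prod_Ico_eq_prod_range]
    have h0 : d + (D + 1) + 1 - (D + 1) = d + 1 := by omega
    rw [h0]
    refine Finset.prod_congr rfl fun l _ => ?_
    rw [pow_add q]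
  have h4 : HahnSeries.ofPowerSeries ℤ F (∏ l ∈ Finset.range (d + 1), EP F (q ^ (D + 1) * q ^ l)) *
      ∏ l ∈ Finset.range (d + 1), (th F - th F ^ (q ^ (D + 1) * q ^ l)) = 1 := by
    rw [map_prod, ← Finset.prod_mul_distrib]
    refine Finset.prod_eq_one fun l _ => EP_inv _ ?_
    rw [← pow_add]
    exact two_le_pow hq (by omega)
  have h5 := right_ne_zero_of_mul_eq_one h4
  rw [gL, gH, ellG_split q D _ (by omega : D ≤ d + (D + 1)), h3, pow_add, map_mul, map_mul,
    HahnSeries.ofPowerSeries_C, map_pow (HahnSeries.ofPowerSeries ℤ F),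
    eq_inv_of_mul_eq_one_left h4]
  generalize (∏ l ∈ Finset.range (d + 1), (th F - th F ^ (q ^ (D + 1) * q ^ l))) = y at h5 ⊢
  rw [mul_pow, inv_pow]
  field_simp

lemma pow_wt (x : LaurentSeries F) (A : List (ℕ × F)) :
    (A.map fun a => x ^ a.1).prod = x ^ (A.map Prod.fst).sum := by
  induction A with
  | nil => simp
  | cons a A ih => simp [ih, pow_add]

/-- Character. -/
def chP (B : List (ℕ × F)) (n : ℕ) : F := (B.map fun a => a.2 ^ n).prod

lemma splitting (q : ℕ) (hq : 2 ≤ q) (D T1 : ℕ) (A : List (ℕ × F)) :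
    ellG F q D ^ (A.map Prod.fst).sum * NS (gL q) 0 A (T1 + (D + 1)) =
      ∑ k ∈ Finset.range (A.length + 1),
        HahnSeries.ofPowerSeries ℤ F (NS (gH q (q ^ (D + 1))) 0 (A.take k) T1) *
        iota F (Polynomial.C (chP (A.take k) (D + 1)) * NS (gP q D) 0 (A.drop k) (D + 1)) := by
  rw [← pow_wt, ← NS_scale, NS_split _ 0 (D + 1) (by omega) _ _ (by omega)]
  refine Finset.sum_congr rfl fun k _ => ?_
  have h1 : NS (fun (a : ℕ × F) d => ellG F q D ^ a.1 * gL q a d) (D + 1) (A.take k)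
      (T1 + (D + 1)) = HahnSeries.C (chP (A.take k) (D + 1)) *
      HahnSeries.ofPowerSeries ℤ F (NS (gH q (q ^ (D + 1))) 0 (A.take k) T1) := by
    have := NS_shift (fun (a : ℕ × F) d => ellG F q D ^ a.1 * gL q a d) 0 (D + 1) (A.take k) T1
    rw [zero_add] at this
    rw [this]
    simp only [high q hq]
    rw [NS_scale (fun a : ℕ × F => HahnSeries.C (a.2 ^ (D + 1))), NS_map, chP, map_list_prod,
      List.map_map]
    rfl
  have h2 : NS (fun (a : ℕ × F) d => ellG F q D ^ a.1 * gL q a d) 0 (A.drop k) (D + 1) =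
      iota F (NS (gP q D) 0 (A.drop k) (D + 1)) := by
    rw [NS_map]
    refine NS_congr _ _ _ _ _ fun a _ d _ hd => low q hq D d (by omega) a
  rw [h1, h2, map_mul, iota_C]
  ring

lemma sum_Ioc_le (q : ℕ) (hq : 2 ≤ q) (d D : ℕ) : ∑ i ∈ Finset.Ioc d D, q ^ i ≤ q ^ (D + 1) := by
  have h3 : ∑ i ∈ Finset.range (D + 1), q ^ i < q ^ (D + 1) := Nat.geomSum_lt hq (by simp)
  refine le_trans (Finset.sum_le_sum_of_subset ?_) h3.le
  intro i hi
  rw [Finset.mem_Ioc] at hi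
  rw [Finset.mem_range]
  omega

lemma prod_deg (q : ℕ) (hq : 2 ≤ q) (d D : ℕ) :
    (∏ i ∈ Finset.Ioc d D, (Polynomial.X - Polynomial.X ^ q ^ i : Polynomial F)).natDegree ≤
      q ^ (D + 1) := by
  refine (Polynomial.natDegree_prod_le _ _).trans (le_trans (Finset.sum_le_sum ?_)
    (sum_Ioc_le q hq d D))
  intro i _
  refine (Polynomial.natDegree_sub_le _ _).trans ?_
  simp only [Polynomial.natDegree_X, Polynomial.natDegree_X_pow]
  exact max_le (Nat.one_le_pow _ _ (by omega)) le_rfl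

lemma gP_deg (q : ℕ) (hq : 2 ≤ q) (D d : ℕ) (a : ℕ × F) :
    (gP q D a d).natDegree ≤ a.1 * q ^ (D + 1) := by
  refine (Polynomial.natDegree_C_mul_le _ _).trans (Polynomial.natDegree_pow_le.trans ?_)
  exact Nat.mul_le_mul_left _ (prod_deg q hq d D)

lemma NSP_deg (q : ℕ) (hq : 2 ≤ q) (D : ℕ) (A : List (ℕ × F)) (hi : ℕ) :
    (NS (gP q D) 0 A hi).natDegree ≤ (A.map Prod.fst).sum * q ^ (D + 1) := by
  induction A generalizing hi with
  | nil => simp [NS_nil]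
  | cons a A ih =>
    rw [NS_cons]
    refine Polynomial.natDegree_sum_le_of_forall_le _ _ fun d _ => ?_
    refine Polynomial.natDegree_mul_le.trans ?_
    rw [List.map_cons, List.sum_cons, add_mul]
    exact add_le_add (gP_deg q hq D d a) (ih d)

lemma ellG_ord (q : ℕ) (hq : 2 ≤ q) (D : ℕ) : Ord (-((q ^ (D + 1) : ℕ) : ℤ)) (ellG F q D) := by
  have h := low q hq D 0 (Nat.zero_le D) ((1 : ℕ), (1 : F))
  have h2 : ellG F q D = iota F (gP q D ((1 : ℕ), (1 : F)) 0) := by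
    rw [← h]
    simp [gL, ellG]
  rw [h2]
  refine Ord.iota ?_
  simpa using gP_deg q hq D 0 ((1 : ℕ), (1 : F))

end Core

/-! ### The core independence theorem -/

section CoreThm

variable {F : Type} [Field F]

set_option maxHeartbeats 1000000 in
theorem core_indep (q N w : ℕ) (hq : 2 ≤ q) (hN : 0 < N) (supp : Finset (List (ℕ × F)))
    (hs : ∀ A ∈ supp, (A.map Prod.fst).sum = w ∧ ∀ a ∈ A, ¬ q ∣ a.1 ∧ a.2 ^ N = 1)
    (a : List (ℕ × F) → Polynomial F) (LiV : List (ℕ × F) → LaurentSeries F)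
    (hLi : ∀ A ∈ supp, ∀ T, 1 ≤ T → Ord ((q ^ T : ℕ) : ℤ) (LiV A - NS (gL q) 0 A T))
    (hrel : ∑ A ∈ supp, iota F (a A) * LiV A = 0) : ∀ A ∈ supp, a A = 0 := by
  by_contra hcon
  push Not at hcon
  obtain ⟨A0, hA0, haA0⟩ := hcon
  let P : Finset ((_ : List (ℕ × F)) × ℕ) := supp.sigma fun A => Finset.range (A.length + 1)
  let I : Finset (List (ℕ × F)) := P.image fun x => x.1.take x.2
  have hwt : ∀ (A : List (ℕ × F)) (k : ℕ), ((A.take k).map Prod.fst).sum +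
      ((A.drop k).map Prod.fst).sum = (A.map Prod.fst).sum := by
    intro A k
    conv_rhs => rw [← List.take_append_drop k A, List.map_append, List.sum_append]
  have hI : ∀ B ∈ I, (B.map Prod.fst).sum ≤ w ∧ ∀ a ∈ B, ¬ q ∣ a.1 ∧ a.2 ^ N = 1 := by
    intro B hB
    simp only [I, P, Finset.mem_image, Finset.mem_sigma] at hB
    obtain ⟨x, hx, rfl⟩ := hB
    have h1 := hwt x.1 x.2
    have h2 := (hs x.1 hx.1).1
    exact ⟨by omega, fun y hy => (hs x.1 hx.1).2 y (List.mem_of_mem_take hy)⟩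
  have hA0I : A0 ∈ I := by
    simp only [I, P, Finset.mem_image, Finset.mem_sigma]
    exact ⟨⟨A0, A0.length⟩, ⟨hA0, by simp⟩, by simp⟩
  obtain ⟨T0, hT0⟩ := spec_indep q N w (w + 1) hq hN I hI
  set J := w + 1 with hJ
  set M := w * q ^ T0 with hM
  set c0 := J + M + 1 with hc0
  set T1 := M + w + 3 + T0 with hT1
  set D := I.card * ((J + 1) * c0) + c0 + ∑ A ∈ supp, (a A).natDegree with hD
  set Q := q ^ (D + 1) with hQdef
  have hQD : D + 1 < Q := Nat.lt_pow_self (by omega)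
  have hqT1 : M + w + 3 ≤ q ^ T1 := by
    have : T1 < q ^ T1 := Nat.lt_pow_self (by omega)
    omega
  have hdega : ∀ A ∈ supp, (a A).natDegree ≤ Q := by
    intro A hA
    have := Finset.single_le_sum (f := fun A => (a A).natDegree) (fun _ _ => Nat.zero_le _) hA
    omega
  let H : List (ℕ × F) → PowerSeries F := fun B => NS (gH q Q) 0 B T1
  let tm : ((_ : List (ℕ × F)) × ℕ) → Polynomial F := fun x =>
    a x.1 * (Polynomial.C (chP (x.1.take x.2) (D + 1)) * NS (gP q D) 0 (x.1.drop x.2) (D + 1))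
  let Y : List (ℕ × F) → Polynomial F := fun B =>
    ∑ x ∈ P with x.1.take x.2 = B, tm x
  -- degree of Y
  have hYdeg : ∀ B, (Y B).natDegree ≤ (w + 1) * Q := by
    intro B
    refine Polynomial.natDegree_sum_le_of_forall_le _ _ fun x hx => ?_
    simp only [P, Finset.mem_filter, Finset.mem_sigma] at hx
    refine Polynomial.natDegree_mul_le.trans ?_
    have h1 := (Polynomial.natDegree_C_mul_le (chP (x.1.take x.2) (D + 1))
      (NS (gP q D) 0 (x.1.drop x.2) (D + 1))).trans (NSP_deg q hq D _ _)
    rw [← hQdef] at h1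
    have h2 := hdega x.1 hx.1.1
    have h3 := hwt x.1 x.2
    have h4 := (hs x.1 hx.1.1).1
    have h5 : ((x.1.drop x.2).map Prod.fst).sum * Q ≤ w * Q := Nat.mul_le_mul_right _ (by omega)
    rw [add_mul, one_mul]
    omega
  -- value at A0
  have hYA0 : Y A0 ≠ 0 := by
    have hfilt : (P.filter fun x => x.1.take x.2 = A0) = {⟨A0, A0.length⟩} := by
      ext ⟨A, k⟩
      simp only [P, Finset.mem_filter, Finset.mem_sigma, Finset.mem_range, Finset.mem_singleton]
      constructor
      · rintro ⟨⟨hA, hk⟩, ht⟩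
        have hk' : k = A.length := by
          by_contra hne
          have h1 := hwt A k
          rw [ht, (hs A hA).1, (hs A0 hA0).1] at h1
          have h2 := length_le_wt q (A.drop k)
            (fun y hy => ((hs A hA).2 y (List.mem_of_mem_drop hy)).1)
          rw [List.length_drop] at h2
          omega
        subst hk'
        rw [List.take_length] at ht
        subst ht
        rfl
      · intro h
        obtain ⟨rfl, h2⟩ := Sigma.mk.inj_iff.1 h
        rw [heq_iff_eq] at h2
        subst h2
        exact ⟨⟨hA0, by omega⟩, by simp⟩
    have : Y A0 = a A0 * Polynomial.C (chP A0 (D + 1)) := by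
      simp only [Y]
      rw [hfilt, Finset.sum_singleton]
      simp [tm, NS_nil]
    rw [this]
    refine mul_ne_zero haA0 ?_
    rw [Ne, Polynomial.C_eq_zero, chP]
    intro h
    rw [List.prod_eq_zero_iff, List.mem_map] at h
    obtain ⟨y, hy, h⟩ := h
    have h1 := ((hs A0 hA0).2 y hy).2
    have h2 : y.2 = 0 := by
      by_contra hh
      exact pow_ne_zero _ hh h
    rw [h2, zero_pow hN.ne'] at h1
    exact zero_ne_one h1
  -- the relation
  have hrel2 : ∑ B ∈ I, HahnSeries.ofPowerSeries ℤ F (H B) * iota F (Y B) =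
      - (ellG F q D ^ w * ∑ A ∈ supp, iota F (a A) * (LiV A - NS (gL q) 0 A (T1 + (D + 1)))) := by
    have h1 : ∑ B ∈ I, HahnSeries.ofPowerSeries ℤ F (H B) * iota F (Y B) =
        ∑ x ∈ P, HahnSeries.ofPowerSeries ℤ F (H (x.1.take x.2)) * iota F (tm x) := by
      rw [← Finset.sum_fiberwise_of_maps_to (s := P) (t := I) (g := fun x => x.1.take x.2)
        (fun x hx => Finset.mem_image_of_mem _ hx)]
      refine Finset.sum_congr rfl fun B _ => ?_
      simp only [Y]
      rw [map_sum, Finset.mul_sum]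
      refine Finset.sum_congr rfl fun x hx => ?_
      rw [(Finset.mem_filter.1 hx).2]
    have h2 : ∑ x ∈ P, HahnSeries.ofPowerSeries ℤ F (H (x.1.take x.2)) * iota F (tm x) =
        ∑ A ∈ supp, iota F (a A) * (ellG F q D ^ w * NS (gL q) 0 A (T1 + (D + 1))) := by
      simp only [P]
      rw [Finset.sum_sigma]
      refine Finset.sum_congr rfl fun A hA => ?_
      rw [← (hs A hA).1, splitting q hq D T1 A, Finset.mul_sum]
      refine Finset.sum_congr rfl fun k _ => ?_
      simp only [tm, H]
      rw [map_mul]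
      ring
    rw [h1, h2]
    have h3 : ∑ A ∈ supp, iota F (a A) * (LiV A - NS (gL q) 0 A (T1 + (D + 1))) =
        - ∑ A ∈ supp, iota F (a A) * NS (gL q) 0 A (T1 + (D + 1)) := by
      simp only [mul_sub, Finset.sum_sub_distrib]
      rw [hrel, zero_sub]
    rw [h3, mul_neg, neg_neg, Finset.mul_sum]
    refine Finset.sum_congr rfl fun A _ => ?_
    ring
  obtain ⟨g, hg0, hgdeg, hg⟩ := exists_g Q J c0 I Y (by omega)
  let Z : List (ℕ × F) → Polynomial F := fun B => g * Y B
  have hZdeg : ∀ B ∈ I, (Z B).natDegree < (J + 1) * Q := by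
    intro B _
    have h1 := Polynomial.natDegree_mul_le (p := g) (q := Y B)
    have h2 : (Y B).natDegree ≤ J * Q := hYdeg B
    simp only [Z]
    rw [add_mul, one_mul]
    omega
  have hrel3 : Ord ((M : ℤ) * Q + 1)
      (∑ b ∈ I, HahnSeries.ofPowerSeries ℤ F (H b) * iota F (Z b)) := by
    have h1 : ∑ b ∈ I, HahnSeries.ofPowerSeries ℤ F (H b) * iota F (Z b) =
        iota F g * ∑ b ∈ I, HahnSeries.ofPowerSeries ℤ F (H b) * iota F (Y b) := by
      rw [Finset.mul_sum]
      refine Finset.sum_congr rfl fun b _ => ?_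
      simp only [Z]
      rw [map_mul]
      ring
    rw [h1, hrel2]
    have o1 : Ord (-(Q : ℤ)) (iota F g) := Ord.iota hgdeg.le
    have o2 : Ord ((w : ℤ) * (-(Q : ℤ))) (ellG F q D ^ w) := (ellG_ord q hq D).pow w
    have o3 : Ord (-(Q : ℤ) + ((q ^ (T1 + (D + 1)) : ℕ) : ℤ))
        (∑ A ∈ supp, iota F (a A) * (LiV A - NS (gL q) 0 A (T1 + (D + 1)))) :=
      Ord.sum fun A hA => (Ord.iota (hdega A hA)).mul (hLi A hA _ (by omega))
    refine (o1.mul (o2.mul o3).neg).mono ?_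
    have e1 : q ^ (T1 + (D + 1)) = q ^ T1 * Q := pow_add _ _ _
    rw [e1]
    have e2 : (M + w + 3) * Q ≤ q ^ T1 * Q := Nat.mul_le_mul_right _ hqT1
    have e3 : ((M : ℤ) + w + 3) * Q ≤ ((q ^ T1 * Q : ℕ) : ℤ) := by exact_mod_cast e2
    have e4 : (1 : ℤ) ≤ Q := by omega
    linarith
  -- minimal residue
  have hex : ∃ r, r < Q ∧ ∃ B ∈ I, ∃ j ≤ J, (Z B).coeff (j * Q + r) ≠ 0 := by
    have hZ0 : Z A0 ≠ 0 := mul_ne_zero hg0 hYA0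
    have hlc : (Z A0).coeff (Z A0).natDegree ≠ 0 := by
      rw [Polynomial.coeff_natDegree]
      exact Polynomial.leadingCoeff_ne_zero.2 hZ0
    have hd := hZdeg A0 hA0I
    refine ⟨(Z A0).natDegree % Q, Nat.mod_lt _ (by omega), A0, hA0I, (Z A0).natDegree / Q, ?_, ?_⟩
    · have : (Z A0).natDegree / Q < J + 1 := Nat.div_lt_of_lt_mul (by rw [mul_comm]; exact hd)
      omega
    · rw [mul_comm, Nat.div_add_mod]
      exact hlc
  set v0 := Nat.find hex with hv0
  obtain ⟨hv0Q, B1, hB1, j1, hj1, hne⟩ := Nat.find_spec hex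
  rw [← hv0] at hne hv0Q
  refine hne (hT0 T1 (by omega) (fun B j => (Z B).coeff (j * Q + v0)) ?_ B1 hB1 j1 hj1)
  intro e he j0 hj0
  refine extract Q J M (by omega) I H (fun B => NS (g2 q) 0 B T1)
    (fun B _ => NSH_mem q Q (by omega) (by omega) B T1) Z hZdeg v0 ?_ hv0Q hrel3 e he j0 hj0
  intro B hB j hj r hr hnz
  refine ⟨Nat.find_min' hex ⟨hr, B, hB, j, hj, hnz⟩, ?_⟩
  by_contra hlt
  apply hnz
  have := hg B hB j hj (r - (Q - c0)) (by omega)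
  rw [show Q - c0 + (r - (Q - c0)) = r by omega] at this
  exact this

end CoreThm

/-! ### Convergence -/

section Conv

variable {F : Type} [Field F]

lemma ord_EP (P : ℕ) : Ord (P : ℤ) (HahnSeries.ofPowerSeries ℤ F (EP F P)) := by
  intro m hm
  rw [PowerSeries.coeff_coe]
  split_ifs with h
  · rfl
  · rw [EP, PowerSeries.coeff_mk, if_neg]
    rintro ⟨k, hk⟩
    have h1 : m.natAbs < P := by omega
    rw [hk] at h1
    omega

lemma Ord.prod_nonneg {ι : Type} (s : Finset ι) (f : ι → LaurentSeries F)
    (h : ∀ i ∈ s, Ord 0 (f i)) : Ord 0 (∏ i ∈ s, f i) := by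
  induction s using Finset.induction_on with
  | empty => simpa using Ord.one
  | insert i s hi ih =>
    rw [Finset.prod_insert hi]
    have := (h i (by simp)).mul (ih fun j hj => h j (by simp [hj]))
    simpa using this

lemma Ord.prod_one {ι : Type} (s : Finset ι) (f : ι → LaurentSeries F) (a : ℤ)
    (h : ∀ i ∈ s, Ord 0 (f i)) (i : ι) (hi : i ∈ s) (ha : Ord a (f i)) :
    Ord a (∏ i ∈ s, f i) := by
  rw [← Finset.mul_prod_erase s f hi]
  have := ha.mul (Ord.prod_nonneg (s.erase i) f fun j hj => h j (Finset.mem_of_mem_erase hj))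
  simpa using this

lemma ellG_inv (q : ℕ) (hq : 2 ≤ q) (d : ℕ) : (ellG F q d)⁻¹ =
    ∏ i ∈ Finset.Icc 1 d, HahnSeries.ofPowerSeries ℤ F (EP F (q ^ i)) := by
  rw [ellG, ← Finset.prod_inv_distrib]
  refine Finset.prod_congr rfl fun i hi => ?_
  rw [Finset.mem_Icc] at hi
  exact (eq_inv_of_mul_eq_one_left (EP_inv _ (two_le_pow hq hi.1))).symm

lemma ord_C (c : F) : Ord 0 (HahnSeries.C c : LaurentSeries F) := by
  intro m hm
  rw [HahnSeries.C_apply, HahnSeries.coeff_single_of_ne (by omega)]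

lemma ord_ell0 (q : ℕ) (hq : 2 ≤ q) (d : ℕ) : Ord 0 (ellG F q d)⁻¹ := by
  rw [ellG_inv q hq]
  exact Ord.prod_nonneg _ _ fun i _ => (ord_EP _).mono (by positivity)

lemma ord_ell (q : ℕ) (hq : 2 ≤ q) (d : ℕ) (hd : 1 ≤ d) :
    Ord ((q ^ d : ℕ) : ℤ) (ellG F q d)⁻¹ := by
  rw [ellG_inv q hq]
  exact Ord.prod_one _ _ _ (fun i _ => (ord_EP _).mono (by positivity)) d (by simp [hd]) (ord_EP _)

lemma ord_gL0 (q : ℕ) (hq : 2 ≤ q) (a : ℕ × F) (d : ℕ) : Ord 0 (gL q a d) := by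
  rw [gL, div_eq_mul_inv, ← inv_pow]
  have := (ord_C (a.2 ^ d)).mul ((ord_ell0 (F := F) q hq d).pow a.1)
  simpa using this

lemma ord_gL (q : ℕ) (hq : 2 ≤ q) (a : ℕ × F) (ha : 0 < a.1) (T d : ℕ) (hT : 1 ≤ T)
    (hd : T ≤ d) : Ord ((q ^ T : ℕ) : ℤ) (gL q a d) := by
  rw [gL, div_eq_mul_inv, ← inv_pow]
  refine ((ord_C (a.2 ^ d)).mul ((ord_ell (F := F) q hq d (by omega)).pow a.1)).mono ?_
  have h1 : q ^ T ≤ q ^ d := Nat.pow_le_pow_right (by omega) hd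
  have h2 : 1 * q ^ d ≤ a.1 * q ^ d := Nat.mul_le_mul_right _ ha
  rw [zero_add]
  exact_mod_cast (by omega : q ^ T ≤ a.1 * q ^ d)

lemma nhds_ord (e : Set (LaurentSeries F)) (he : e ∈ nhds (0 : LaurentSeries F)) :
    ∃ n : ℤ, ∀ f : LaurentSeries F, Ord n f → f ∈ e := by
  rw [Valued.mem_nhds_zero] at he
  obtain ⟨γ, hγ⟩ := he
  have hne : MonoidWithZeroHom.ValueGroup₀.embedding γ.1 ≠ 0 := by
    rw [map_ne_zero]
    exact γ.ne_zero
  obtain ⟨k, hk⟩ : ∃ k : ℤ, MonoidWithZeroHom.ValueGroup₀.embedding γ.1 = WithZero.exp k :=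
    ⟨WithZero.log (MonoidWithZeroHom.ValueGroup₀.embedding γ.1), (WithZero.exp_log hne).symm⟩
  refine ⟨1 - k, fun f hf => hγ ?_⟩
  have h1 := (LaurentSeries.valuation_le_iff_coeff_lt_eq_zero F (D := 1 - k) (f := f)).2 hf
  show Valued.v.restrict f < γ.1
  rw [Valued.v.restrict_lt_iff_lt_embedding, hk]
  refine lt_of_le_of_lt h1 ?_
  rw [WithZero.exp_lt_exp]
  omega

lemma tsum_ord {β : Type} (t : β → LaurentSeries F) (S : ℕ → Finset β) (q : ℕ) (hq : 2 ≤ q)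
    (h : ∀ T, 1 ≤ T → ∀ b ∉ S T, Ord ((q ^ T : ℕ) : ℤ) (t b)) (T : ℕ) (hT : 1 ≤ T) :
    Ord ((q ^ T : ℕ) : ℤ) (∑' b, t b - ∑ b ∈ S T, t b) := by
  have hsum : Summable t := by
    rw [summable_iff_vanishing]
    intro e he
    obtain ⟨n, hn⟩ := nhds_ord e he
    refine ⟨S (n.toNat + 1), fun s hs => hn _ (Ord.sum fun b hb => ?_)⟩
    refine (h (n.toNat + 1) (by omega) b (Finset.disjoint_left.1 hs hb)).mono ?_
    have : n.toNat + 1 < q ^ (n.toNat + 1) := Nat.lt_pow_self (by omega)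
    omega
  intro m hm
  letI : UniformSpace F := ⊥
  haveI : DiscreteTopology F := ⟨rfl⟩
  have hc : Continuous fun f : LaurentSeries F => f.coeff m :=
    (LaurentSeries.uniformContinuous_coeff m).continuous
  have h1 := (hc.tendsto _).comp hsum.hasSum
  rw [nhds_discrete, Filter.tendsto_pure] at h1
  obtain ⟨s, hs1, hs2⟩ := (h1.and (Filter.eventually_ge_atTop (S T))).exists
  simp only [Function.comp] at hs1
  rw [HahnSeries.coeff_sub, ← hs1, ← HahnSeries.coeff_sub, ← Finset.sum_sdiff hs2,
    add_sub_cancel_right]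
  refine Ord.sum (fun b hb => h T hT b ?_) m hm
  rw [Finset.mem_sdiff] at hb
  exact hb.2

lemma Li_ord (q : ℕ) (hq : 2 ≤ q) (n : ℕ) (u : Fin n → ℕ × F) (hu : ∀ i, 0 < (u i).1)
    (T : ℕ) (hT : 1 ≤ T) :
    Ord ((q ^ T : ℕ) : ℤ) (∑' f : {f : Fin n → ℕ // StrictAnti f}, ∏ i, gL q (u i) (f.1 i) -
      NS (gL q) 0 (List.ofFn u) T) := by
  have hfin : ∀ T, {f : {f : Fin n → ℕ // StrictAnti f} | ∀ i, f.1 i < T}.Finite := by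
    intro T
    have h1 : {f : Fin n → ℕ | ∀ i, f i < T}.Finite := by
      have := Set.Finite.pi' (fun _ : Fin n => Set.finite_Iio T)
      exact this
    exact h1.preimage Subtype.val_injective.injOn
  have := tsum_ord (fun f : {f : Fin n → ℕ // StrictAnti f} => ∏ i, gL q (u i) (f.1 i))
    (fun T => (hfin T).toFinset) q hq (by
      intro T hT f hf
      rw [Set.Finite.mem_toFinset] at hf
      simp only [Set.mem_setOf_eq, not_forall, not_lt] at hf
      obtain ⟨i, hi⟩ := hf
      exact Ord.prod_one _ _ _ (fun i _ => ord_gL0 q hq _ _) i (Finset.mem_univ i)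
        (ord_gL q hq _ (hu i) T _ hT hi)) T hT
  convert this using 2
  rw [NS_eq_sum, List.length_ofFn]
  symm
  refine Finset.sum_bij (fun f _ => List.ofFn f.1) ?_ ?_ ?_ ?_
  · intro f hf
    rw [Set.Finite.mem_toFinset] at hf
    rw [mem_Dec]
    refine ⟨by simp, ?_, ?_⟩
    · rw [List.pairwise_ofFn]
      intro i j hij
      exact f.2 hij
    · intro x hx
      rw [List.mem_ofFn] at hx
      obtain ⟨i, rfl⟩ := hx
      exact hf i
  · intro f _ g _ hfg
    exact Subtype.ext (List.ofFn_injective hfg)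
  · intro l hl
    rw [mem_Dec] at hl
    obtain ⟨rfl, h2, h3⟩ := hl
    refine ⟨⟨l.get, ?_⟩, ?_, List.ofFn_get l⟩
    · intro i j hij
      exact (List.pairwise_iff_getElem.1 h2) i j i.2 j.2 hij
    · rw [Set.Finite.mem_toFinset]
      intro i
      exact h3 _ (List.get_mem l i)
  · intro f _
    rw [← List.prod_ofFn]
    congr 1
    refine List.ext_getElem (by simp) ?_
    intro i h1 h2
    simp

end Conv

/-! ### Final assembly -/

section Final

lemma two_le_qc (Fq : Type) [Field Fq] [Fintype Fq] : 2 ≤ qc Fq := Fintype.one_lt_card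

lemma Rdeg_pos (Fq : Type) [Field Fq] [Fintype Fq] (N : ℕ) (hN : 0 < N) : 0 < Rdeg Fq N := by
  have hne : {r | 0 < r ∧ ∀ x : Fb Fq, x ^ N = 1 → x ^ qc Fq ^ r = x}.Nonempty := by
    have : NeZero N := ⟨hN.ne'⟩
    obtain ⟨i, j, hij, h⟩ := Finite.exists_ne_map_eq_of_infinite
      (fun i : ℕ => ((qc Fq ^ i : ℕ) : ZMod N))
    wlog hlt : i < j generalizing i j with H
    · exact H j i hij.symm h.symm (by omega)
    refine ⟨j - i, by omega, fun x hx => ?_⟩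
    have h1 : qc Fq ^ i ≡ qc Fq ^ j [MOD N] := (ZMod.natCast_eq_natCast_iff _ _ _).1 h
    have h2 : x ^ qc Fq ^ i = x ^ qc Fq ^ j := by
      rw [← Nat.mod_add_div (qc Fq ^ i) N, ← Nat.mod_add_div (qc Fq ^ j) N, pow_add, pow_add,
        pow_mul, pow_mul, hx, one_pow, one_pow, h1]
    have hinj : ∀ k : ℕ, Function.Injective fun y : Fb Fq => y ^ qc Fq ^ k := by
      intro k
      have h3 := (FiniteField.frobeniusAlgHom Fq (Fb Fq)).toRingHom.injective.iterate k
      convert h3 using 1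
      funext y
      clear h3
      induction k with
      | zero => simp
      | succ k ih =>
        rw [Function.iterate_succ_apply', ← ih, pow_succ, pow_mul]
        rfl
    apply hinj i
    simp only
    rw [← pow_mul, ← pow_add, Nat.sub_add_cancel hlt.le, h2]
  exact (Nat.sInf_mem hne).1

lemma mu_ne (Fq : Type) [Field Fq] [Fintype Fq] (N : ℕ) (hN : 0 < N) (m x : Fb Fq)
    (hx : x ^ N = 1) (h : m ^ (qc Fq ^ Rdeg Fq N - 1) = x ^ Rdeg Fq N) : m ≠ 0 := by
  rintro rfl
  have h1 := two_le_pow (two_le_qc Fq) (Rdeg_pos Fq N hN)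
  rw [zero_pow (by omega)] at h
  have h2 : x = 0 := by
    by_contra hh
    exact pow_ne_zero _ hh h.symm
  rw [h2, zero_pow hN.ne'] at hx
  exact zero_ne_one hx

lemma clear_den (Fq : Type) [Field Fq] [Fintype Fq] (c : Kinf Fq) (hc : c ∈ Fbtheta Fq) :
    ∃ y z : Polynomial (Fb Fq), iota (Fb Fq) z ≠ 0 ∧ c * iota (Fb Fq) z = iota (Fb Fq) y := by
  rw [Fbtheta, Subfield.mem_closure_iff] at hc
  have hle : Subring.closure ((Set.range fun x : Fb Fq => cst Fq x) ∪ {theta Fq}) ≤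
      (iota (Fb Fq)).range := by
    rw [Subring.closure_le]
    rintro _ (⟨x, rfl⟩ | h)
    · exact ⟨Polynomial.C x, iota_C x⟩
    · rw [Set.mem_singleton_iff] at h
      rw [h]
      exact ⟨Polynomial.X, iota_X⟩
  obtain ⟨y, hy, z, hz, rfl⟩ := hc
  obtain ⟨y', rfl⟩ := hle hy
  obtain ⟨z', rfl⟩ := hle hz
  by_cases h : iota (Fb Fq) z' = 0
  · exact ⟨0, 1, by simp, by simp [h]⟩
  · exact ⟨y', z', h, by field_simp⟩

/-- The word of an array. -/
def word {F : Type} (A : PArr F) : List (ℕ × F) := List.ofFn fun i => (A.s i, A.eps i)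

lemma word_inj {F : Type} : Function.Injective (word (F := F)) := by
  rintro ⟨n, s, e⟩ ⟨n', s', e'⟩ h
  have h1 := List.ofFn_inj'.1 h
  obtain ⟨h2, h3⟩ := Sigma.mk.inj_iff.1 h1
  simp only at h2
  subst h2
  rw [heq_iff_eq] at h3
  have h4 : s = s' := funext fun i => congrArg Prod.fst (congrFun h3 i)
  have h5 : e = e' := funext fun i => congrArg Prod.snd (congrFun h3 i)
  rw [h4, h5]

lemma word_sum {F : Type} (A : PArr F) : ((word A).map Prod.fst).sum = A.wt := by
  rw [word, List.map_ofFn, List.sum_ofFn]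
  rfl

lemma Li_ord' (Fq : Type) [Field Fq] [Fintype Fq] (A : PArr (Fb Fq)) (h : ∀ i, 0 < A.s i)
    (T : ℕ) (hT : 1 ≤ T) :
    Ord ((qc Fq ^ T : ℕ) : ℤ) (Li Fq A - NS (gL (qc Fq)) 0 (word A) T) :=
  Li_ord (qc Fq) (two_le_qc Fq) A.depth (fun i => (A.s i, A.eps i)) h T hT

end Final

/-- **Linear independence over `𝔽̄_q(θ)`** (homogeneous part of Theorem
`trans CMPL at roots of unity`): the family `{μ(𝛆)·Li(𝛆;𝔰) : 𝔰 ∈ S_w, 𝛆 ∈ Γ_N^{depth 𝔰}}`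
is linearly independent over `𝔽̄_q(θ)` inside `𝔽̄_q((1/θ))`. -/
theorem mu_Li_linearly_independent_over_Fqbar_theta
    (Fq : Type) [Field Fq] [Fintype Fq] (N w : ℕ) (hN : 0 < N) (hw : 0 < w)
    (μ : Fb Fq → Fb Fq)
    (hμ : ∀ x : Fb Fq, x ^ N = 1 → μ x ^ (qc Fq ^ Rdeg Fq N - 1) = x ^ Rdeg Fq N) :
    LinearIndependent (Fbtheta Fq)
      (fun A : SwIdx Fq N w => cst Fq (∏ i, μ (A.1.eps i)) * Li Fq A.1) := by
  rw [linearIndependent_iff']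
  intro s c hc A hA
  choose y z hz hyz using fun B : SwIdx Fq N w => clear_den Fq (c B : Kinf Fq) (c B).2
  let wd : SwIdx Fq N w → List (ℕ × Fb Fq) := fun B => word B.1
  have hwd : Function.Injective wd := fun B B' h => Subtype.ext (word_inj h)
  let aS : SwIdx Fq N w → Polynomial (Fb Fq) := fun B =>
    y B * (∏ B' ∈ s.erase B, z B') * Polynomial.C (∏ i, μ (B.1.eps i))
  have haS : ∀ B ∈ s, iota (Fb Fq) (aS B) =
      iota (Fb Fq) (∏ B' ∈ s, z B') * ((c B : Kinf Fq) * cst Fq (∏ i, μ (B.1.eps i))) := by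
    intro B hB
    simp only [aS]
    rw [map_mul, map_mul, iota_C, ← hyz, ← Finset.mul_prod_erase s z hB, map_mul, cst]
    ring
  have hext : ∀ B, Function.extend wd aS 0 (wd B) = aS B := fun B => hwd.extend_apply _ _ _
  have hextL : ∀ B, Function.extend wd (fun B => Li Fq B.1) 0 (wd B) = Li Fq B.1 :=
    fun B => hwd.extend_apply _ _ _
  have hcore := core_indep (qc Fq) N w (two_le_qc Fq) hN (s.image wd) (by
      intro l hl
      rw [Finset.mem_image] at hl
      obtain ⟨B, _, rfl⟩ := hl
      refine ⟨(word_sum B.1).trans B.2.2.2.1, ?_⟩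
      intro a ha
      simp only [wd, word, List.mem_ofFn] at ha
      obtain ⟨i, rfl⟩ := ha
      exact ⟨B.2.2.2.2 i, B.2.1.2 i⟩)
    (Function.extend wd aS 0) (Function.extend wd (fun B => Li Fq B.1) 0) (by
      intro l hl T hT
      rw [Finset.mem_image] at hl
      obtain ⟨B, _, rfl⟩ := hl
      rw [hextL]
      exact Li_ord' Fq B.1 B.2.1.1 T hT) (by
      rw [Finset.sum_image (fun _ _ _ _ h => hwd h)]
      simp only [hext, hextL]
      have h1 : ∀ B ∈ s, iota (Fb Fq) (aS B) * Li Fq B.1 = iota (Fb Fq) (∏ B' ∈ s, z B') *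
          (c B • (cst Fq (∏ i, μ (B.1.eps i)) * Li Fq B.1)) := by
        intro B hB
        rw [haS B hB, Subfield.smul_def, smul_eq_mul]
        ring
      rw [Finset.sum_congr rfl h1, ← Finset.mul_sum, hc, mul_zero])
    (wd A) (Finset.mem_image_of_mem _ hA)
  rw [hext] at hcore
  have h2 := haS A hA
  rw [hcore, map_zero] at h2
  have h3 : iota (Fb Fq) (∏ B' ∈ s, z B') ≠ 0 := by
    rw [map_prod, Finset.prod_ne_zero_iff]
    exact fun B _ => hz B
  have h4 : cst Fq (∏ i, μ (A.1.eps i)) ≠ 0 := by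
    rw [map_ne_zero, Finset.prod_ne_zero_iff]
    intro i _
    exact mu_ne Fq N hN _ _ (A.2.1.2 i) (hμ _ (A.2.1.2 i))
  have h5 := ((mul_eq_zero.1 h2.symm).resolve_left h3)
  exact Subtype.ext ((mul_eq_zero.1 h5).resolve_right h4)

end ZHPC
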